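/- arXiv:1201.5471 — 2 statements merged into one kernel-verified Lean document; each statement's English description precedes it below -/
import Mathlib

section
/- A weakly closed bounded (not necessarily convex) subset F of ℓ^∞ is weakly compact if and only if every functional μ ∈ (ℓ^∞)* of the form μ = Σ_{n=1}^∞ α_n δ_{s_n}, with Σ|α_n| = 1 and s_n ∈ βℕ (δ_{s_n} the Dirac measure at s_n), attains its supremum on F. -/
open Filter Topology Metric Bornology

noncomputable section

variable {X : Type*} [NormedAddCommGroup X] [NormedSpace ℝ X]

/-- Topology of pointwise convergence on a set `D` of functionals. -/
def ptwTop (D : Set (X →L[ℝ] ℝ)) : TopologicalSpace X :=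
  TopologicalSpace.induced (fun x (d : D) => (d : X →L[ℝ] ℝ) x) Pi.topologicalSpace

/-- Weak-star topology on the dual of `X`. -/
def wstarTop (X : Type*) [NormedAddCommGroup X] [NormedSpace ℝ X] :
    TopologicalSpace (X →L[ℝ] ℝ) :=
  TopologicalSpace.induced (fun f (x : X) => f x) Pi.topologicalSpace

/-- Weak-star closure of a set of functionals. -/
def wstarClosure (A : Set (X →L[ℝ] ℝ)) : Set (X →L[ℝ] ℝ) :=
  @closure _ (wstarTop X) A

/-- Weak topology on `X`. -/
def weakTop (X : Type*) [NormedAddCommGroup X] [NormedSpace ℝ X] :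
    TopologicalSpace X :=
  TopologicalSpace.induced (fun x (f : X →L[ℝ] ℝ) => f x) Pi.topologicalSpace

/-- `aco_∞(A)`: absolutely convex series combinations of elements of `A`. -/
def acoInf (A : Set X) : Set X :=
  {x | ∃ (α : ℕ → ℝ) (u : ℕ → X), (∀ n, u n ∈ A) ∧ Summable (fun n => |α n|) ∧
    (∑' n, |α n|) = 1 ∧ HasSum (fun n => α n • u n) x}

/-- absolutely convex hull -/
def aco (A : Set X) : Set X := convexHull ℝ (A ∪ -A)

/-- subspace topology -/
def subTop {α : Type*} (t : TopologicalSpace α) (s : Set α) : TopologicalSpace s :=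
  TopologicalSpace.induced (Subtype.val : s → α) t

/-- The space `ℓ¹` of absolutely summable real sequences. -/
abbrev Ell : Type := lp (fun _ : ℕ => ℝ) 1

namespace Ell

/-- The unit vectors of `ℓ¹`. -/
def unit (n : ℕ) : Ell := lp.single 1 n 1

lemma norm_unit (n : ℕ) : ‖unit n‖ = 1 := by
  simp [unit, lp.norm_single]

lemma unit_self (n : ℕ) : unit n n = 1 := by
  simp [unit]

lemma unit_of_ne {n m : ℕ} (h : m ≠ n) : unit n m = 0 := by
  rw [unit, lp.single_apply_ne _ _ _ h]

lemma unit_nonneg (n m : ℕ) : 0 ≤ unit n m := by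
  rcases eq_or_ne m n with rfl | h
  · simp [unit_self]
  · simp [unit_of_ne h]

@[simp] lemma add_apply (a b : Ell) (n : ℕ) : (a + b) n = a n + b n := by
  simp

@[simp] lemma sub_apply (a b : Ell) (n : ℕ) : (a - b) n = a n - b n := by
  simp

@[simp] lemma smul_apply (t : ℝ) (a : Ell) (n : ℕ) : (t • a) n = t * a n := by
  simp [lp.coeFn_smul]

@[simp] lemma zero_apply (n : ℕ) : (0 : Ell) n = 0 := by
  simp

lemma hasSum_abs (a : Ell) : HasSum (fun n => |a n|) ‖a‖ := by
  have := lp.hasSum_norm (p := 1) (by simp) a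
  simpa using this

lemma summable_abs (a : Ell) : Summable (fun n => |a n|) := a.hasSum_abs.summable

lemma summable_mul {h : ℕ → ℝ} {L : ℝ} (hh : ∀ n, |h n| ≤ L) (a : Ell) :
    Summable fun n => a n * h n := by
  refine Summable.of_norm_bounded (g := fun n => |a n| * L) (a.summable_abs.mul_right L) fun n => ?_
  rw [Real.norm_eq_abs, abs_mul]
  exact mul_le_mul_of_nonneg_left (hh n) (abs_nonneg _)

lemma abs_tsum_mul_le {h : ℕ → ℝ} {L : ℝ} (hh : ∀ n, |h n| ≤ L) (a : Ell) :
    |∑' n, a n * h n| ≤ L * ‖a‖ := by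
  have h1 : ‖∑' n, a n * h n‖ ≤ ‖a‖ * L := by
    refine tsum_of_norm_bounded (a.hasSum_abs.mul_right L) fun n => ?_
    rw [Real.norm_eq_abs, abs_mul]
    exact mul_le_mul_of_nonneg_left (hh n) (abs_nonneg _)
  rw [mul_comm]
  exact h1

/-- The functional on `ℓ¹` induced by a sequence bounded by `L`. -/
def pair (h : ℕ → ℝ) (L : ℝ) (hh : ∀ n, |h n| ≤ L) : Ell →L[ℝ] ℝ :=
  LinearMap.mkContinuous
    { toFun := fun a => ∑' n, a n * h n
      map_add' := fun a b => by
        rw [← (summable_mul hh a).tsum_add (summable_mul hh b)]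
        simp [add_mul]
      map_smul' := fun t a => by
        simp [mul_assoc, tsum_mul_left] }
    L fun a => abs_tsum_mul_le hh a

lemma pair_apply {h : ℕ → ℝ} {L : ℝ} (hh : ∀ n, |h n| ≤ L) (a : Ell) :
    pair h L hh a = ∑' n, a n * h n := rfl

lemma pair_unit {h : ℕ → ℝ} {L : ℝ} (hh : ∀ n, |h n| ≤ L) (n : ℕ) :
    pair h L hh (unit n) = h n := by
  rw [pair_apply, tsum_eq_single n fun m hm => by simp [unit_of_ne hm], unit_self, one_mul]

/-- The total mass `∑ a n` of an element of `ℓ¹`. -/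
def mass : Ell →L[ℝ] ℝ := pair (fun _ => 1) 1 (by simp)

lemma mass_of_nonneg {a : Ell} (ha : ∀ n, 0 ≤ a n) : mass a = ‖a‖ := by
  rw [mass, pair_apply, ← a.hasSum_abs.tsum_eq]
  exact tsum_congr fun n => by rw [abs_of_nonneg (ha n), mul_one]

lemma norm_add_of_nonneg {a b : Ell} (ha : ∀ n, 0 ≤ a n) (hb : ∀ n, 0 ≤ b n) :
    ‖a + b‖ = ‖a‖ + ‖b‖ := by
  rw [← mass_of_nonneg ha, ← mass_of_nonneg hb, ← map_add, mass_of_nonneg]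
  intro n
  simpa using add_nonneg (ha n) (hb n)

lemma hasSum_unit (a : Ell) : HasSum (fun n => a n • unit n) a := by
  have h := lp.hasSum_single (p := 1) (by simp) a
  convert h using 2 with n
  rw [unit, ← lp.single_smul, smul_eq_mul, mul_one]

lemma continuous_eval (n : ℕ) : Continuous fun a : Ell => a n :=
  (lp.lipschitzWith_one_eval 1 n).continuous

/-- Sublinear functionals on `ℓ¹` bounded above by `L` times the norm. -/
structure Sublinear (P : Ell → ℝ) (L : ℝ) : Prop where
  add_le : ∀ a b, P (a + b) ≤ P a + P b
  smul : ∀ t a, 0 ≤ t → P (t • a) = t * P a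
  le_norm : ∀ a, P a ≤ L * ‖a‖

namespace Sublinear

variable {P : Ell → ℝ} {L : ℝ}

lemma zero (hP : Sublinear P L) : P 0 = 0 := by
  simpa using hP.smul 0 0 le_rfl

lemma bound_nonneg (hP : Sublinear P L) : 0 ≤ L := by
  have h1 := hP.le_norm (unit 0)
  have h2 := hP.le_norm (-unit 0)
  have h3 := hP.add_le (unit 0) (-unit 0)
  rw [add_neg_cancel, hP.zero] at h3
  rw [norm_neg, norm_unit] at h2
  rw [norm_unit] at h1
  linarith

lemma le_add_norm (hP : Sublinear P L) (a b : Ell) : P a ≤ P b + L * ‖a - b‖ := by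
  have h := hP.add_le b (a - b)
  rw [add_sub_cancel] at h
  linarith [hP.le_norm (a - b)]

lemma sub_norm_le (hP : Sublinear P L) (a c : Ell) : P a - L * ‖c‖ ≤ P (a + c) := by
  have := hP.le_add_norm a (a + c)
  rw [sub_add_cancel_left, norm_neg] at this
  linarith

lemma add_le_norm (hP : Sublinear P L) (a c : Ell) : P (a + c) ≤ P a + L * ‖c‖ := by
  have := hP.le_add_norm (a + c) a
  rwa [add_sub_cancel_left] at this

lemma continuous (hP : Sublinear P L) : Continuous P := by
  have : LipschitzWith ⟨L, hP.bound_nonneg⟩ P := by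
    refine LipschitzWith.of_le_add_mul _ fun a b => ?_
    rw [dist_eq_norm]
    exact hP.le_add_norm a b
  exact this.continuous

lemma convex (hP : Sublinear P L) (b c : Ell) {t : ℝ} (h0 : 0 ≤ t) (h1 : t ≤ 1) :
    P (b + t • c) ≤ (1 - t) * P b + t * P (b + c) := by
  rw [← hP.smul _ b (sub_nonneg.2 h1), ← hP.smul _ _ h0]
  refine le_of_eq_of_le ?_ (hP.add_le _ _)
  congr 1
  module

end Sublinear

lemma Sublinear.le_of_hasSum {P : Ell → ℝ} {L : ℝ} (hP : Sublinear P L) {x : ℕ → Ell} {y : ℕ → ℝ}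
    {X : Ell} {Y : ℝ} (hx : HasSum x X) (hy : HasSum y Y) (h : ∀ n, P (x n) ≤ y n) : P X ≤ Y := by
  refine le_of_tendsto_of_tendsto' ((hP.continuous.tendsto X).comp hx) hy fun s => ?_
  simp only [Function.comp_apply]
  induction s using Finset.cons_induction with
  | empty => simp [hP.zero]
  | cons a s ha ih =>
    rw [Finset.sum_cons, Finset.sum_cons]
    exact (hP.add_le _ _).trans (add_le_add (h a) ih)

/-- Closed convex cones of nonnegative elements of `ℓ¹` supported in `A` that contain nonzero
elements with arbitrarily late support. -/
structure TailCone (A : Set ℕ) (D : Set Ell) : Prop where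
  closed : IsClosed D
  zero : 0 ∈ D
  add : ∀ a ∈ D, ∀ b ∈ D, a + b ∈ D
  smul : ∀ t : ℝ, 0 ≤ t → ∀ a ∈ D, t • a ∈ D
  nonneg : ∀ a ∈ D, ∀ n, 0 ≤ a n
  supp : ∀ a ∈ D, ∀ n, n ∉ A → a n = 0
  full : ∀ N : ℕ, ∃ c ∈ D, c ≠ 0 ∧ ∀ n < N, c n = 0

namespace TailCone

variable {A : Set ℕ} {D : Set Ell}

lemma sum_mem (hD : TailCone A D) {x : ℕ → Ell} (hx : ∀ n, x n ∈ D) (s : Finset ℕ) :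
    ∑ n ∈ s, x n ∈ D := by
  induction s using Finset.cons_induction with
  | empty => simpa using hD.zero
  | cons a s ha ih =>
    rw [Finset.sum_cons]
    exact hD.add _ (hx a) _ ih

lemma hasSum_mem (hD : TailCone A D) {x : ℕ → Ell} {X : Ell} (hX : HasSum x X)
    (hx : ∀ n, x n ∈ D) : X ∈ D :=
  hD.closed.mem_of_tendsto hX (Eventually.of_forall fun s => hD.sum_mem hx s)

lemma norm_add (hD : TailCone A D) {a b : Ell} (ha : a ∈ D) (hb : b ∈ D) :
    ‖a + b‖ = ‖a‖ + ‖b‖ :=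
  norm_add_of_nonneg (hD.nonneg a ha) (hD.nonneg b hb)

lemma mass_eq (hD : TailCone A D) {a : Ell} (ha : a ∈ D) : mass a = ‖a‖ :=
  mass_of_nonneg (hD.nonneg a ha)

lemma exists_norm_eq (hD : TailCone A D) (N : ℕ) {β : ℝ} (hβ : 0 ≤ β) :
    ∃ c ∈ D, ‖c‖ = β ∧ ∀ n < N, c n = 0 := by
  obtain ⟨c, hc, h0, hN⟩ := hD.full N
  have : 0 < ‖c‖ := norm_pos_iff.2 h0
  refine ⟨(β / ‖c‖) • c, hD.smul _ (by positivity) _ hc, ?_, fun n hn => by simp [hN n hn]⟩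
  rw [norm_smul, Real.norm_of_nonneg (by positivity)]
  field_simp

/-- A variational principle of Ekeland type along a cone. -/
lemma exists_ekeland (hD : TailCone A D) {P : Ell → ℝ} {L : ℝ} (hP : Sublinear P L)
    (x : Ell) (τ R : ℝ) (hR : ∀ c ∈ D, P (x + c) ≤ P x + τ * ‖c‖ → ‖c‖ ≤ R) :
    ∃ c ∈ D, P (x + c) ≤ P x + τ * ‖c‖ ∧
      ∀ c' ∈ D, P (x + c) + τ * ‖c'‖ ≤ P (x + c + c') := by
  let T : Ell → Set Ell := fun c => {d | d ∈ D ∧ P (x + c + d) ≤ P (x + c) + τ * ‖d‖}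
  let S : Set Ell := {c | c ∈ D ∧ P (x + c) ≤ P x + τ * ‖c‖}
  have hTS : ∀ c ∈ S, ∀ d ∈ T c, c + d ∈ S := by
    rintro c ⟨hc, hc'⟩ d ⟨hd, hd'⟩
    refine ⟨hD.add _ hc _ hd, ?_⟩
    rw [hD.norm_add hc hd, ← add_assoc]
    linarith
  have h0T : ∀ c, 0 ∈ T c := fun c => ⟨hD.zero, by simp⟩
  have key : ∀ c : S, ∃ d ∈ T c, ∀ d' ∈ T c, ‖d'‖ ≤ 2 * ‖d‖ := by
    rintro ⟨c, hc⟩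
    by_cases h : ∀ d' ∈ T c, ‖d'‖ ≤ 0
    · exact ⟨0, h0T c, fun d' hd' => by simpa using h d' hd'⟩
    push Not at h
    obtain ⟨d₁, hd₁, hpos⟩ := h
    have hbdd : BddAbove (norm '' T c) := by
      refine ⟨R, ?_⟩
      rintro _ ⟨d, hd, rfl⟩
      have h1 := hR (c + d) (hTS c hc d hd).1 (hTS c hc d hd).2
      rw [hD.norm_add hc.1 hd.1] at h1
      linarith [norm_nonneg c]
    have hM : 0 < sSup (norm '' T c) := hpos.trans_le (le_csSup hbdd ⟨d₁, hd₁, rfl⟩)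
    obtain ⟨_, ⟨d, hd, rfl⟩, hlt⟩ := exists_lt_of_lt_csSup (s := norm '' T c) ⟨_, d₁, hd₁, rfl⟩
      (half_lt_self hM)
    exact ⟨d, hd, fun d' hd' => (le_csSup hbdd ⟨d', hd', rfl⟩).trans (by linarith)⟩
  choose d hdT hdmax using key
  let c : ℕ → S := fun k => Nat.rec ⟨0, hD.zero, by simp⟩
    (fun _ c => ⟨c + d c, hTS c c.2 _ (hdT c)⟩) k
  have hc_succ : ∀ k, (c (k + 1)).1 = (c k).1 + d (c k) := fun _ => rfl
  have hsum : ∀ k, (c k).1 = ∑ j ∈ Finset.range k, d (c j) := by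
    intro k
    induction k with
    | zero => rfl
    | succ k ih => rw [Finset.sum_range_succ, ← ih, hc_succ]
  have hnsum : ∀ k, ‖(c k).1‖ = ∑ j ∈ Finset.range k, ‖d (c j)‖ := by
    intro k
    induction k with
    | zero => exact _root_.norm_zero
    | succ k ih => rw [Finset.sum_range_succ, ← ih, hc_succ, hD.norm_add (c k).2.1 (hdT _).1]
  have hsummable : Summable fun j => ‖d (c j)‖ :=
    summable_of_sum_range_le (fun _ => norm_nonneg _) fun k => by
      rw [← hnsum]
      exact hR _ (c k).2.1 (c k).2.2
  obtain ⟨C, hC⟩ := hsummable.of_norm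
  have hlim : Tendsto (fun k => (c k).1) atTop (𝓝 C) := by
    simpa only [hsum] using hC.tendsto_sum_nat
  have hstep : ∀ k m, (c (k + m)).1 - (c k).1 ∈ D ∧
      P (x + (c (k + m)).1) ≤ P (x + (c k).1) + τ * ‖(c (k + m)).1 - (c k).1‖ := by
    intro k m
    induction m with
    | zero => simpa using hD.zero
    | succ m ih =>
      have h1 : (c (k + (m + 1))).1 - (c k).1 = ((c (k + m)).1 - (c k).1) + d (c (k + m)) := by
        rw [← add_assoc, hc_succ]; abel
      have h2 := hdT (c (k + m))
      rw [h1, hD.norm_add ih.1 h2.1]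
      refine ⟨hD.add _ ih.1 _ h2.1, ?_⟩
      rw [← add_assoc k, hc_succ, ← add_assoc]
      linarith [ih.2, h2.2]
  have htail : ∀ k, C - (c k).1 ∈ D ∧ P (x + C) ≤ P (x + (c k).1) + τ * ‖C - (c k).1‖ := by
    intro k
    have hl : Tendsto (fun m => (c (k + m)).1) atTop (𝓝 C) := by
      simpa only [add_comm k] using (tendsto_add_atTop_iff_nat k).2 hlim
    refine ⟨hD.closed.mem_of_tendsto (hl.sub_const _) (Eventually.of_forall fun m => (hstep k m).1),
      le_of_tendsto_of_tendsto' ((hP.continuous.tendsto _).comp (hl.const_add x))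
        (((hl.sub_const _).norm.const_mul τ).const_add _) fun m => (hstep k m).2⟩
  have hc0 : (c 0).1 = 0 := rfl
  refine ⟨C, by simpa [hc0] using (htail 0).1, by simpa [hc0] using (htail 0).2, ?_⟩
  intro c' hc'
  by_contra! hlt
  have hle : ∀ k, ‖c'‖ ≤ 2 * ‖d (c k)‖ := by
    intro k
    have h1 := htail k
    have h2 : (C - (c k).1) + c' ∈ T (c k).1 := by
      refine ⟨hD.add _ h1.1 _ hc', ?_⟩
      rw [hD.norm_add h1.1 hc', show x + (c k).1 + (C - (c k).1 + c') = x + C + c' by abel]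
      linarith [h1.2]
    have h3 := hdmax _ _ h2
    rw [hD.norm_add h1.1 hc'] at h3
    linarith [norm_nonneg (C - (c k).1)]
  have h0 : ‖c'‖ ≤ 2 * 0 := ge_of_tendsto' (hsummable.tendsto_atTop_zero.const_mul 2) hle
  have : c' = 0 := norm_le_zero_iff.1 (by linarith)
  subst this
  simp at hlt

end TailCone

end Ell

namespace Ell
namespace TailCone

variable {A : Set ℕ} {D : Set Ell} {P : Ell → ℝ} {L : ℝ}

lemma exists_slope (hD : TailCone A D) (hP : Sublinear P L) (b : Ell) {τ ξ : ℝ} (hξ : 0 < ξ)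
    (hτ : ∀ c ∈ D, P b + τ * ‖c‖ ≤ P (b + c)) :
    ∃ q β : ℝ, τ ≤ q ∧ 0 < β ∧
      (∀ γ > 0, ∃ N : ℕ, ∀ c ∈ D, (∀ n < N, c n = 0) → ‖c‖ = γ → P b + q * γ ≤ P (b + c)) ∧
      (∀ N : ℕ, ∃ c ∈ D, (∀ n < N, c n = 0) ∧ ‖c‖ = β ∧ P (b + c) < P b + (q + ξ) * β) := by
  let Q : Set ℝ := {q | ∀ γ > 0, ∃ N : ℕ, ∀ c ∈ D, (∀ n < N, c n = 0) → ‖c‖ = γ →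
    P b + q * γ ≤ P (b + c)}
  have hτQ : τ ∈ Q := fun γ _ => ⟨0, fun c hc _ hcn => hcn ▸ hτ c hc⟩
  have hbdd : BddAbove Q := by
    refine ⟨L, fun q hq => ?_⟩
    obtain ⟨N, hN⟩ := hq 1 one_pos
    obtain ⟨c, hc, hc1, hcN⟩ := hD.exists_norm_eq N zero_le_one
    have h1 := hN c hc hcN hc1
    have h2 := hP.add_le_norm b c
    rw [hc1] at h2
    linarith
  obtain ⟨q₀, hq₀, hlt⟩ := exists_lt_of_lt_csSup ⟨τ, hτQ⟩ (sub_lt_self (sSup Q) hξ)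
  have hq : max q₀ τ ∈ Q := by
    rcases max_choice q₀ τ with h | h <;> rw [h] <;> assumption
  have hnot : max q₀ τ + ξ ∉ Q := fun h => by
    have h1 := le_csSup hbdd h
    have h2 := le_max_left q₀ τ
    linarith
  simp only [Q, Set.mem_ofPred_eq, not_forall, not_exists] at hnot
  obtain ⟨β, hβ, hN⟩ := hnot
  refine ⟨max q₀ τ, β, le_max_right _ _, hβ, hq, fun N => ?_⟩
  obtain ⟨c, hc, hcN, hcβ, h⟩ := hN N
  exact ⟨c, hc, hcN, hcβ, not_le.1 h⟩

lemma subcone (hD : TailCone A D) (hP : Sublinear P L) (b : Ell) {β u : ℝ} (N₁ : ℕ) (hβ : 0 < β)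
    (h : ∀ N : ℕ, ∃ c ∈ D, (∀ n < N, c n = 0) ∧ ‖c‖ = β ∧ P (b + c) < P b + u * β) :
    TailCone A {c | c ∈ D ∧ (∀ n < N₁, c n = 0) ∧
      P (mass c • b + β • c) ≤ mass c * (P b + u * β)} where
  closed := by
    have h1 : IsClosed {c : Ell | ∀ n < N₁, c n = 0} := by
      simp only [← Set.iInter_ofPred]
      exact isClosed_iInter fun n => isClosed_iInter fun _ =>
        isClosed_eq (continuous_eval n) continuous_const
    have h2 : IsClosed {c : Ell | P (mass c • b + β • c) ≤ mass c * (P b + u * β)} :=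
      isClosed_le (hP.continuous.comp
        ((mass.continuous.smul continuous_const).add (continuous_id.const_smul β)))
        (mass.continuous.mul continuous_const)
    exact hD.closed.inter (h1.inter h2)
  zero := ⟨hD.zero, fun n _ => zero_apply n, by simp [hP.zero]⟩
  add := by
    rintro c ⟨hc, hcN, hcP⟩ d ⟨hd, hdN, hdP⟩
    refine ⟨hD.add _ hc _ hd, fun n hn => by simp [hcN n hn, hdN n hn], ?_⟩
    have := hP.add_le (mass c • b + β • c) (mass d • b + β • d)
    rw [map_add, show (mass c + mass d) • b + β • (c + d)
      = mass c • b + β • c + (mass d • b + β • d) by module]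
    linarith
  smul := by
    rintro t ht c ⟨hc, hcN, hcP⟩
    refine ⟨hD.smul t ht _ hc, fun n hn => by simp [hcN n hn], ?_⟩
    rw [map_smul, smul_eq_mul, show (t * mass c) • b + β • t • c = t • (mass c • b + β • c) by module,
      hP.smul t _ ht, mul_assoc]
    exact mul_le_mul_of_nonneg_left hcP ht
  nonneg c hc := hD.nonneg c hc.1
  supp c hc := hD.supp c hc.1
  full N := by
    obtain ⟨c, hc, hcN, hcβ, hcP⟩ := h (max N N₁)
    refine ⟨c, ⟨hc, fun n hn => hcN n (hn.trans_le (le_max_right _ _)), ?_⟩, ?_,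
      fun n hn => hcN n (hn.trans_le (le_max_left _ _))⟩
    · rw [hD.mass_eq hc, hcβ, ← smul_add, hP.smul _ _ hβ.le]
      exact mul_le_mul_of_nonneg_left hcP.le hβ.le
    · rw [← norm_pos_iff, hcβ]
      exact hβ

lemma upper_of_mem_subcone (hP : Sublinear P L) (b c : Ell) {β u : ℝ} (hβ : 0 < β)
    (hm : mass c = ‖c‖) (hc : ‖c‖ ≤ β)
    (h : P (mass c • b + β • c) ≤ mass c * (P b + u * β)) : P (b + c) ≤ P b + u * ‖c‖ := by
  rw [hm] at h
  have h1 : P (b + c) ≤ P ((1 - ‖c‖ / β) • b) + P (β⁻¹ • (‖c‖ • b + β • c)) := by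
    refine le_of_eq_of_le ?_ (hP.add_le _ _)
    congr 1
    rw [smul_add, smul_smul, smul_smul, inv_mul_cancel₀ hβ.ne', one_smul, ← add_assoc, ← add_smul]
    rw [show 1 - ‖c‖ / β + β⁻¹ * ‖c‖ = 1 by ring, one_smul]
  rw [hP.smul _ _ (sub_nonneg.2 ((div_le_one hβ).2 hc)), hP.smul _ _ (by positivity)] at h1
  have h2 := mul_le_mul_of_nonneg_left h (inv_nonneg.2 hβ.le)
  have h3 : β⁻¹ * (‖c‖ * (P b + u * β)) = ‖c‖ / β * P b + u * ‖c‖ := by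
    field_simp
  linarith

lemma lower_of_norm_eq (hD : TailCone A D) (hP : Sublinear P L) (b : Ell) {q γ : ℝ} (hγ : 0 < γ)
    {N : ℕ} (h : ∀ c ∈ D, (∀ n < N, c n = 0) → ‖c‖ = γ → P b + q * γ ≤ P (b + c))
    {c : Ell} (hc : c ∈ D) (hcN : ∀ n < N, c n = 0) (hle : γ ≤ ‖c‖) :
    P b + q * ‖c‖ ≤ P (b + c) := by
  have hpos : 0 < ‖c‖ := hγ.trans_le hle
  have ht : 0 < γ / ‖c‖ := by positivity
  have h1 := h ((γ / ‖c‖) • c) (hD.smul _ ht.le _ hc) (fun n hn => by simp [hcN n hn])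
    (by rw [norm_smul, Real.norm_of_nonneg ht.le]; field_simp)
  have h2 := hP.convex b c ht.le ((div_le_one hpos).2 hle)
  have h3 : γ / ‖c‖ * (q * ‖c‖) ≤ γ / ‖c‖ * (P (b + c) - P b) := by
    rw [show γ / ‖c‖ * (q * ‖c‖) = q * γ by field_simp]
    linarith
  linarith [le_of_mul_le_mul_left h3 ht]

/-- By averaging over a unit mass in the cone, one unit vector can be added at almost the
slope valid on the cone. -/
lemma exists_unit (hD : TailCone A D) (hP : Sublinear P L) (b : Ell) {q γ ξ : ℝ} (hγ : 0 < γ)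
    (hξ : 0 < ξ) (N : ℕ) (hN : ∀ c ∈ D, ∀ n < N, c n = 0)
    (h : ∀ c ∈ D, γ ≤ ‖c‖ → P b + q * ‖c‖ ≤ P (b + c)) :
    ∃ n ∈ A, N ≤ n ∧ ∀ c ∈ D, P b + (q - ξ) * (γ + ‖c‖) ≤ P (b + γ • unit n + c) := by
  by_contra! hcon
  have key : ∀ n, ∃ c ∈ D, ‖c‖ ≤ max γ ((q + L) * γ / ξ) ∧
      (n ∈ A → N ≤ n → P (b + γ • unit n + c) < P b + (q - ξ) * (γ + ‖c‖)) := by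
    intro n
    by_cases hn : n ∈ A ∧ N ≤ n
    · obtain ⟨c, hc, hlt⟩ := hcon n hn.1 hn.2
      refine ⟨c, hc, ?_, fun _ _ => hlt⟩
      rcases le_total ‖c‖ γ with h1 | h1
      · exact h1.trans (le_max_left _ _)
      · refine le_trans ?_ (le_max_right _ _)
        rw [le_div_iff₀ hξ]
        have h2 := h c hc h1
        have h3 := hP.sub_norm_le (b + c) (γ • unit n)
        rw [norm_smul, norm_unit, Real.norm_of_nonneg hγ.le,
          show b + c + γ • unit n = b + γ • unit n + c by abel] at h3
        nlinarith [mul_pos hξ hγ]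
    · exact ⟨0, hD.zero, by simp [hγ.le], fun h1 h2 => absurd ⟨h1, h2⟩ hn⟩
  choose c hcD hcM hc using key
  obtain ⟨φ, hφ, hφ1, -⟩ := hD.exists_norm_eq 0 zero_le_one
  have hφ0 := hD.nonneg φ hφ
  have hφsum : HasSum (fun n => φ n) 1 := by
    have := φ.hasSum_abs
    simpa only [abs_of_nonneg (hφ0 _), hφ1] using this
  have hsm : Summable fun n => φ n • c n := by
    refine Summable.of_norm_bounded (hφsum.summable.mul_right (max γ ((q + L) * γ / ξ))) fun n => ?_
    rw [norm_smul, Real.norm_of_nonneg (hφ0 n)]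
    exact mul_le_mul_of_nonneg_left (hcM n) (hφ0 n)
  obtain ⟨w, hw⟩ := hsm
  have hwD : w ∈ D := hD.hasSum_mem hw fun n => hD.smul _ (hφ0 n) _ (hcD n)
  have hwn : HasSum (fun n => φ n * ‖c n‖) ‖w‖ := by
    have h1 := hw.mapL mass
    simpa only [map_smul, smul_eq_mul, hD.mass_eq (hcD _), hD.mass_eq hwD] using h1
  have hX : HasSum (fun n => φ n • (b + γ • unit n + c n)) (b + γ • φ + w) := by
    have h1 := ((hφsum.smul_const b).add (φ.hasSum_unit.const_smul γ)).add hw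
    rw [one_smul] at h1
    convert h1 using 2
    module
  have hY : HasSum (fun n => φ n * (P b + (q - ξ) * (γ + ‖c n‖)))
      (P b + (q - ξ) * (γ + ‖w‖)) := by
    have h1 := (hφsum.mul_right (P b + (q - ξ) * γ)).add (hwn.mul_left (q - ξ))
    rw [show P b + (q - ξ) * (γ + ‖w‖) = 1 * (P b + (q - ξ) * γ) + (q - ξ) * ‖w‖ by ring]
    exact h1.congr_fun fun n => by ring
  have hle := hP.le_of_hasSum hX hY fun n => by
    rw [hP.smul _ _ (hφ0 n)]
    by_cases hn : n ∈ A ∧ N ≤ n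
    · exact mul_le_mul_of_nonneg_left (hc n hn.1 hn.2).le (hφ0 n)
    · have : φ n = 0 := by
        by_cases hA : n ∈ A
        · exact hN φ hφ n (not_le.1 fun h1 => hn ⟨hA, h1⟩)
        · exact hD.supp φ hφ n hA
      simp [this]
  have hmem : γ • φ + w ∈ D := hD.add _ (hD.smul _ hγ.le _ hφ) _ hwD
  have hnorm : ‖γ • φ + w‖ = γ + ‖w‖ := by
    rw [hD.norm_add (hD.smul _ hγ.le _ hφ) hwD, norm_smul, hφ1, Real.norm_of_nonneg hγ.le, mul_one]
  have hlow := h _ hmem (by rw [hnorm]; linarith [norm_nonneg w])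
  rw [hnorm, ← add_assoc] at hlow
  nlinarith [mul_pos hξ hγ, mul_nonneg hξ.le (norm_nonneg w)]

/-- One step of the perturbation argument: from slope `τ` along `D` pass to slope `τ - s` along a
smaller cone, after moving `b` by a small amount in such a way that removing the new multiple of
a unit vector decreases `P` definitely. -/
lemma exists_step (hD : TailCone A D) (hP : Sublinear P L) (b : Ell) {τ η s r : ℝ} (hη : 0 < η)
    (hητ : η ≤ τ) (hs : 0 < s) (hr : 0 < r) (N₀ : ℕ)
    (hτ : ∀ c ∈ D, P b + τ * ‖c‖ ≤ P (b + c)) :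
    ∃ (γ : ℝ) (n : ℕ) (c : Ell) (D' : Set Ell), 0 < γ ∧ N₀ ≤ n ∧ n ∈ A ∧ TailCone A D' ∧
      γ + ‖c‖ ≤ r ∧
      (∀ c' ∈ D', P (b + γ • unit n + c) + (τ - s) * ‖c'‖ ≤ P (b + γ • unit n + c + c')) ∧
      P (b + c) + η / 2 * γ ≤ P (b + γ • unit n + c) := by
  have hL := hP.bound_nonneg
  set ξ := min (s / 2) (min (η / 4) (η * s / (16 * (L + 1)))) with hξdef
  have hξ : 0 < ξ := by positivity
  have hξs : ξ ≤ s / 2 := min_le_left _ _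
  have hξη : ξ ≤ η / 4 := (min_le_right _ _).trans (min_le_left _ _)
  have hξL : ξ ≤ η * s / (16 * (L + 1)) := (min_le_right _ _).trans (min_le_right _ _)
  obtain ⟨q, β, hq, hβ, hlow, hup⟩ := hD.exists_slope hP b hξ hτ
  set γ := min r β / (1 + 2 * L / s) with hγdef
  have hγ : 0 < γ := by positivity
  have hγeq : γ + 2 * L / s * γ = min r β := by
    rw [hγdef]; field_simp
  obtain ⟨N, hN⟩ := hlow γ hγ
  set N₁ := max N N₀
  have hD' := hD.subcone hP b N₁ hβ hup
  set D' := {c | c ∈ D ∧ (∀ n < N₁, c n = 0) ∧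
    P (mass c • b + β • c) ≤ mass c * (P b + (q + ξ) * β)}
  obtain ⟨n, hnA, hnN, hn⟩ := hD'.exists_unit hP b (q := q) hγ hξ N₁ (fun c hc => hc.2.1)
    fun c hc hle => hD.lower_of_norm_eq hP b hγ hN hc.1
      (fun n hn => hc.2.1 n (hn.trans_le (le_max_left _ _))) hle
  have hPu : P (b + γ • unit n) ≤ P b + L * γ := by
    have := hP.add_le_norm b (γ • unit n)
    rwa [norm_smul, norm_unit, Real.norm_of_nonneg hγ.le, mul_one] at this
  obtain ⟨c, hc, hadm, hmax⟩ := hD'.exists_ekeland hP (b + γ • unit n) (q - s) (2 * L / s * γ) (by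
    intro c hc hle
    have h1 := hn c hc
    have h2 : s * ‖c‖ ≤ 2 * L * γ := by
      nlinarith [mul_nonneg (norm_nonneg c) (sub_nonneg.2 hξs),
        mul_nonneg hγ.le (show 0 ≤ q - ξ by linarith)]
    rw [div_mul_eq_mul_div, le_div_iff₀ hs]
    linarith)
  have hcn : ‖c‖ ≤ 2 * L / s * γ := by
    have h1 := hn c hc
    have h2 : s * ‖c‖ ≤ 2 * L * γ := by
      nlinarith [mul_nonneg (norm_nonneg c) (sub_nonneg.2 hξs),
        mul_nonneg hγ.le (show 0 ≤ q - ξ by linarith)]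
    rw [div_mul_eq_mul_div, le_div_iff₀ hs]
    linarith
  refine ⟨γ, n, c, D', hγ, (le_max_right _ _).trans hnN, hnA, hD', ?_, ?_, ?_⟩
  · linarith [min_le_left r β]
  · intro c' hc'
    have := hmax c' hc'
    have h1 : (τ - s) * ‖c'‖ ≤ (q - s) * ‖c'‖ :=
      mul_le_mul_of_nonneg_right (by linarith) (norm_nonneg _)
    linarith
  · have h1 := hn c hc
    have h2 := upper_of_mem_subcone hP b c hβ (hD.mass_eq hc.1)
      (by linarith [min_le_right r β]) hc.2.2
    have h3 : 2 * ξ * ‖c‖ ≤ η / 4 * γ := by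
      have e1 : ξ * (16 * (L + 1)) ≤ η * s := (le_div_iff₀ (by positivity)).1 hξL
      have e2 : s * ‖c‖ ≤ 2 * L * γ := by
        rw [div_mul_eq_mul_div, le_div_iff₀ hs] at hcn
        linarith
      have e3 : s * (2 * ξ * ‖c‖) ≤ s * (η / 4 * γ) := by
        nlinarith [mul_le_mul_of_nonneg_left e2 (by positivity : 0 ≤ 2 * ξ),
          mul_le_mul_of_nonneg_right e1 hγ.le, mul_pos hξ hγ]
      exact le_of_mul_le_mul_left e3 hs
    nlinarith [mul_nonneg hγ.le (show 0 ≤ q - η by linarith), mul_nonneg hγ.le (sub_nonneg.2 hξη)]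

end TailCone
lemma tailCone_nonneg {A : Set ℕ} (hA : A.Infinite) :
    TailCone A {a : Ell | ∀ n, 0 ≤ a n ∧ (n ∉ A → a n = 0)} where
  closed := by
    have h (n : ℕ) : IsClosed {a : Ell | 0 ≤ a n ∧ (n ∉ A → a n = 0)} := by
      by_cases hn : n ∈ A
      · simpa [hn] using isClosed_le continuous_const (continuous_eval n)
      · simp only [hn, not_false_eq_true, true_imp_iff]
        exact (isClosed_le continuous_const (continuous_eval n)).inter
          (isClosed_eq (continuous_eval n) continuous_const)
    rw [← Set.iInter_ofPred]
    exact isClosed_iInter h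
  zero n := by simp
  add a ha b hb n := ⟨by simpa using add_nonneg (ha n).1 (hb n).1,
    fun hn => by simp [(ha n).2 hn, (hb n).2 hn]⟩
  smul t ht a ha n := ⟨by simpa using mul_nonneg ht (ha n).1, fun hn => by simp [(ha n).2 hn]⟩
  nonneg a ha n := (ha n).1
  supp a ha n := (ha n).2
  full N := by
    obtain ⟨n, hn, hN⟩ := hA.exists_gt N
    refine ⟨unit n, fun m => ⟨unit_nonneg n m, fun hm => unit_of_ne ?_⟩, ?_, fun m hm =>
      unit_of_ne (hm.trans hN).ne⟩
    · rintro rfl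
      exact hm hn
    · rw [← norm_pos_iff, norm_unit]
      exact one_pos

/-- The data carried along the iteration of `TailCone.exists_step`. -/
structure Stage (P : Ell → ℝ) (A : Set ℕ) (η : ℝ) where
  pt : Ell
  cone : Set Ell
  rad : ℝ
  start : ℕ
  slope : ℝ
  tailCone : TailCone A cone
  rad_pos : 0 < rad
  lt_slope : η < slope
  le_slope : ∀ c ∈ cone, P pt + slope * ‖c‖ ≤ P (pt + c)

lemma Stage.exists_next {P : Ell → ℝ} {L : ℝ} (hP : Sublinear P L) {A : Set ℕ} {η ε : ℝ}
    (hη : 0 < η) (hε : 0 < ε) (x : Stage P A η) :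
    ∃ (y : Stage P A η) (γ : ℝ) (n : ℕ) (c : Ell), 0 < γ ∧ x.start ≤ n ∧ n ∈ A ∧
      γ + ‖c‖ ≤ x.rad ∧ P (x.pt + c) + η / 2 * γ ≤ P y.pt ∧
      y.pt = x.pt + γ • unit n + c ∧ y.rad = ε * γ ∧ y.start = n + 1 := by
  have hlt := x.lt_slope
  obtain ⟨γ, n, c, D', hγ, hn, hnA, hD', hr, hD, hP'⟩ := x.tailCone.exists_step hP x.pt hη hlt.le
    (half_pos (sub_pos.2 hlt)) x.rad_pos x.start x.le_slope
  exact ⟨⟨_, D', ε * γ, n + 1, _, hD', by positivity, by linarith, hD⟩, γ, n, c, hγ, hn, hnA, hr,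
    hP', rfl, rfl, rfl⟩

/-- A sublinear functional on `ℓ¹` with a definite slope along nonnegative elements
has a point at which infinitely many one-coordinate perturbations have a uniform linear decrease. -/
theorem exists_perturbation {P : Ell → ℝ} {L : ℝ} (hP : Sublinear P L) {A : Set ℕ}
    (hA : A.Infinite) {δ : ℝ} (hδ : 0 < δ) (h : ∀ a : Ell, (∀ n, 0 ≤ a n) → δ * ‖a‖ ≤ P a) :
    ∃ (b : Ell) (n : ℕ → ℕ) (γ : ℕ → ℝ) (ρ : ℝ), StrictMono n ∧ 0 < ρ ∧
      ∀ i, n i ∈ A ∧ 0 < γ i ∧ P (b - γ i • unit (n i)) + ρ * γ i ≤ P b := by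
  have hL := hP.bound_nonneg
  set η := δ / 2 with hη_def
  have hη : 0 < η := by positivity
  set ε := min (1 / 2) (η / (16 * (L + 1))) with hε_def
  have hε : 0 < ε := by positivity
  have hεh : ε ≤ 1 / 2 := min_le_left _ _
  have hεL : ε * (16 * (L + 1)) ≤ η := (le_div_iff₀ (by positivity)).1 (min_le_right _ _)
  choose next γ n c hγ hstart hnA hrad hPstep hpt hnrad hnstart using
    fun x : Stage P A η => x.exists_next hP hη hε
  let x₀ : Stage P A η := ⟨0, _, 1, 0, δ, tailCone_nonneg hA, one_pos, by linarith, fun c hc => by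
    simpa [hP.zero] using h c fun n => (hc n).1⟩
  let x : ℕ → Stage P A η := fun k => next^[k] x₀
  have hx : ∀ k, x (k + 1) = next (x k) := fun k => Function.iterate_succ_apply' _ _ _
  have hrad_succ : ∀ k, (x (k + 1)).rad ≤ (x k).rad / 2 := fun k => by
    rw [hx, hnrad]
    nlinarith [hrad (x k), norm_nonneg (c (x k)), hγ (x k)]
  have hrad_le : ∀ k m, (x (k + m)).rad ≤ 2 * (x k).rad / 2 / 2 ^ m := fun k m => by
    induction m with
    | zero => simp
    | succ m ih =>
      rw [pow_succ, ← div_div, ← add_assoc]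
      exact (hrad_succ _).trans (div_le_div_of_nonneg_right ih zero_le_two)
  have hdist : ∀ k, dist (x k).pt (x (k + 1)).pt ≤ (x k).rad := fun k => by
    rw [hx, hpt, dist_eq_norm, add_assoc, sub_add_cancel_left, norm_neg]
    refine (norm_add_le _ _).trans (le_trans (le_of_eq ?_) (hrad (x k)))
    rw [norm_smul, norm_unit, Real.norm_of_nonneg (hγ _).le, mul_one]
  have hgeom : ∀ k m, dist (x (k + m)).pt (x (k + (m + 1))).pt ≤ 2 * (x k).rad / 2 / 2 ^ m :=
    fun k m => (hdist _).trans (hrad_le k m)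
  obtain ⟨b, hb⟩ := cauchySeq_tendsto_of_complete
    (cauchySeq_of_le_geometric_two (f := fun k => (x k).pt) (C := 2 * (x 0).rad) fun m => by
      simpa using hgeom 0 m)
  have hbk : ∀ k, ‖b - (x k).pt‖ ≤ 2 * (x k).rad := fun k => by
    rw [← dist_eq_norm, dist_comm]
    refine dist_le_of_le_geometric_two_of_tendsto₀ (f := fun m => (x (k + m)).pt)
      (hgeom k) ?_
    simpa only [add_comm k] using (tendsto_add_atTop_iff_nat k).2 hb
  refine ⟨b, fun i => n (x i), fun i => γ (x i), η / 4, ?_, by positivity, fun i => ?_⟩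
  · refine strictMono_nat_of_lt_succ fun i => ?_
    have h1 := hstart (x (i + 1))
    rw [hx, hnstart] at h1
    rw [hx]
    omega
  · refine ⟨hnA _, hγ _, ?_⟩
    have h1 := hbk (i + 1)
    rw [hx, hnrad] at h1
    have h2 := hP.le_add_norm (b - γ (x i) • unit (n (x i))) ((x i).pt + c (x i))
    have h3 : b - γ (x i) • unit (n (x i)) - ((x i).pt + c (x i)) = b - (next (x i)).pt := by
      rw [hpt]; abel
    rw [h3] at h2
    have h4 := hP.le_add_norm (next (x i)).pt b
    rw [norm_sub_rev] at h4
    have h5 := hPstep (x i)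
    have h6 := mul_le_mul_of_nonneg_left h1 hL
    have h7 := mul_le_mul_of_nonneg_right hεL (hγ (x i)).le
    nlinarith [mul_pos hε (hγ (x i))]

/-- The support functional on `ℓ¹` of a family of bounded sequences. -/
def supFun {Γ : Type*} (h : Γ → ℕ → ℝ) (a : Ell) : ℝ := ⨆ x, ∑' n, a n * h x n

section supFun

variable {Γ : Type*} {h : Γ → ℕ → ℝ} {L : ℝ}

lemma bddAbove_range_pairing (hh : ∀ x n, |h x n| ≤ L) (a : Ell) :
    BddAbove (Set.range fun x => ∑' n, a n * h x n) := by
  refine ⟨L * ‖a‖, ?_⟩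
  rintro _ ⟨x, rfl⟩
  exact (le_abs_self _).trans (abs_tsum_mul_le (hh x) a)

lemma le_supFun (hh : ∀ x n, |h x n| ≤ L) (a : Ell) (x : Γ) :
    ∑' n, a n * h x n ≤ supFun h a :=
  le_ciSup (bddAbove_range_pairing hh a) x

lemma sublinear_supFun [Nonempty Γ] (hh : ∀ x n, |h x n| ≤ L) : Sublinear (supFun h) L where
  add_le a b := ciSup_le fun x => by
    rw [← pair_apply (hh x), map_add]
    exact add_le_add (le_supFun hh a x) (le_supFun hh b x)
  smul t a ht := by
    rw [supFun, supFun, Real.mul_iSup_of_nonneg ht]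
    exact iSup_congr fun x => by
      rw [← pair_apply (hh x), map_smul, smul_eq_mul, pair_apply]
  le_norm a := ciSup_le fun x => (le_abs_self _).trans (abs_tsum_mul_le (hh x) a)

end supFun

/-- If uniformly bounded nonnegative continuous functions on a compact space tend to zero
pointwise, then some combination with nonnegative coefficients is uniformly small. -/
theorem exists_supFun_lt {K : Type*} [TopologicalSpace K] [CompactSpace K] [Nonempty K]
    {g : ℕ → K → ℝ} {L : ℝ} (hg : ∀ n, Continuous (g n)) (hL : ∀ x n, |g n x| ≤ L)
    (hlim : ∀ x, Tendsto (fun n => g n x) atTop (𝓝 0)) {δ : ℝ} (hδ : 0 < δ) :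
    ∃ a : Ell, (∀ n, 0 ≤ a n) ∧ supFun (fun x n => g n x) a < δ * ‖a‖ := by
  by_contra! hcon
  have hP : Sublinear (supFun fun x n => g n x) L := sublinear_supFun hL
  obtain ⟨b, n, γ, ρ, hn, hρ, h⟩ := exists_perturbation hP Set.infinite_univ hδ hcon
  have hcont : Continuous fun x => ∑' n, b n * g n x := by
    refine continuous_tsum (fun n => (hg n).const_mul (b n)) (b.summable_abs.mul_right L)
      fun n x => ?_
    rw [Real.norm_eq_abs, abs_mul]
    exact mul_le_mul_of_nonneg_left (hL x n) (abs_nonneg _)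
  obtain ⟨x, -, hx⟩ := isCompact_univ.exists_isMaxOn Set.univ_nonempty hcont.continuousOn
  have hxle : supFun (fun x n => g n x) b ≤ ∑' n, b n * g n x :=
    ciSup_le fun y => hx (Set.mem_univ y)
  have hge : ∀ i, ρ ≤ g (n i) x := by
    intro i
    obtain ⟨-, hγ, hi⟩ := h i
    have h1 := le_supFun (h := fun x n => g n x) hL (b - γ i • unit (n i)) x
    rw [← pair_apply (hL x), map_sub, map_smul, pair_unit, smul_eq_mul, pair_apply] at h1
    have h2 : γ i * ρ ≤ γ i * g (n i) x := by linarith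
    exact le_of_mul_le_mul_left h2 hγ
  have := ge_of_tendsto' ((hlim x).comp hn.tendsto_atTop) hge
  linarith

instance : TopologicalSpace.SeparableSpace Ell := by
  rw [← TopologicalSpace.isSeparable_univ_iff]
  have h : TopologicalSpace.IsSeparable (Submodule.span ℝ (Set.range unit) : Set Ell) :=
    (Set.countable_range unit).isSeparable.span
  refine h.closure.mono fun a _ => mem_closure_of_tendsto a.hasSum_unit
    (Eventually.of_forall fun s => ?_)
  exact Submodule.sum_mem _ fun n _ => Submodule.smul_mem _ _ (Submodule.subset_span ⟨n, rfl⟩)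

end Ell

/-- Inclusion of sets of natural numbers up to finitely many elements. -/
def AlmostSub (N' N : Set ℕ) : Prop := ∀ᶠ n in atTop, n ∈ N' → n ∈ N

lemma AlmostSub.refl (N : Set ℕ) : AlmostSub N N := Eventually.of_forall fun _ => id

lemma AlmostSub.trans {N₁ N₂ N₃ : Set ℕ} (h₁ : AlmostSub N₁ N₂) (h₂ : AlmostSub N₂ N₃) :
    AlmostSub N₁ N₃ := by
  filter_upwards [h₁, h₂] with n h₁ h₂ h using h₂ (h₁ h)

lemma exists_almostSub_of_decreasing {N : ℕ → Set ℕ} (hinf : ∀ k, ∃ᶠ n in atTop, n ∈ N k)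
    (hdec : ∀ k, AlmostSub (N (k + 1)) (N k)) :
    ∃ M : Set ℕ, (∃ᶠ n in atTop, n ∈ M) ∧ ∀ k, AlmostSub M (N k) := by
  have hle : ∀ j m, AlmostSub (N (j + m)) (N j) := fun j m => by
    induction m with
    | zero => exact AlmostSub.refl _
    | succ m ih => exact (hdec _).trans ih
  have hfreq : ∀ k, ∃ᶠ n in atTop, ∀ j ≤ k, n ∈ N j := fun k => by
    have h1 : ∀ᶠ n in atTop, ∀ j ∈ Set.Iic k, n ∈ N k → n ∈ N j :=
      (eventually_all_finite (Set.finite_Iic k)).2 fun j hj => by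
        obtain ⟨m, rfl⟩ := Nat.exists_eq_add_of_le hj
        exact hle j m
    exact ((hinf k).and_eventually h1).mono fun n hn j hj => hn.2 j hj hn.1
  obtain ⟨φ, hφ, hφN⟩ := extraction_forall_of_frequently hfreq
  refine ⟨Set.range φ, ?_, fun k => ?_⟩
  · exact Nat.frequently_atTop_iff_infinite.2 (Set.infinite_range_of_injective hφ.injective)
  · filter_upwards [eventually_ge_atTop (φ k)]
    rintro _ h ⟨m, rfl⟩
    exact hφN m k (hφ.le_iff_le.1 h)

/-- Countably many monotone bounded functions on infinite sets ordered by almost inclusion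
can be stabilised simultaneously. -/
lemma exists_stable (w : ℕ → Set ℕ → ℝ) (C : ℕ → ℝ)
    (hC : ∀ j N, (∃ᶠ n in atTop, n ∈ N) → w j N ≤ C j)
    (hw : ∀ j N N', (∃ᶠ n in atTop, n ∈ N') → AlmostSub N' N → w j N ≤ w j N') :
    ∃ M : Set ℕ, (∃ᶠ n in atTop, n ∈ M) ∧
      ∀ j N, (∃ᶠ n in atTop, n ∈ N) → AlmostSub N M → w j N = w j M := by
  let I : Type := {N : Set ℕ // ∃ᶠ n in atTop, n ∈ N}
  have key : ∀ (m : ℕ) (N : I), ∃ N' : I, AlmostSub N'.1 N.1 ∧ ∀ N'' : I, AlmostSub N''.1 N.1 →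
      w m.unpair.1 N''.1 ≤ w m.unpair.1 N'.1 + 1 / (m.unpair.2 + 1 : ℝ) := by
    intro m N
    let S : Set ℝ := {y | ∃ N' : I, AlmostSub N'.1 N.1 ∧ w m.unpair.1 N'.1 = y}
    have hS : BddAbove S := ⟨C m.unpair.1, by rintro _ ⟨N', -, rfl⟩; exact hC _ _ N'.2⟩
    obtain ⟨_, ⟨N', hN', rfl⟩, hlt⟩ := exists_lt_of_lt_csSup (s := S) ⟨_, N, AlmostSub.refl _, rfl⟩
      (sub_lt_self (sSup S) (Nat.one_div_pos_of_nat (n := m.unpair.2)))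
    refine ⟨N', hN', fun N'' hN'' => ?_⟩
    have := le_csSup hS ⟨N'', hN'', rfl⟩
    linarith
  choose next hsub hnext using key
  let N : ℕ → I := fun k => Nat.rec ⟨Set.univ, Eventually.frequently (by simp)⟩ (fun m N => next m N) k
  obtain ⟨M, hM, hMN⟩ := exists_almostSub_of_decreasing (N := fun k => (N k).1)
    (fun k => (N k).2) (fun k => hsub k (N k))
  refine ⟨M, hM, fun j N' hN' hsubM => le_antisymm ?_ (hw j _ _ hN' hsubM)⟩
  have hk : ∀ k : ℕ, w j N' ≤ w j M + 1 / (k + 1 : ℝ) := by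
    intro k
    have h1 := hnext (Nat.pair j k) (N (Nat.pair j k)) ⟨N', hN'⟩ (hsubM.trans (hMN _))
    simp only [Nat.unpair_pair] at h1
    have h2 := hw j _ _ hM (hMN (Nat.pair j k + 1))
    exact h1.trans (add_le_add_left h2 _)
  have := ge_of_tendsto' (tendsto_one_div_add_atTop_nhds_zero_nat.const_add (w j M)) hk
  simpa using this

section

variable {K : Type*} [TopologicalSpace K]

/-- Cluster points of the sequence `s` along the set of indices `N`. -/
def clusterSet (s : ℕ → K) (N : Set ℕ) : Set K := {t | MapClusterPt t (atTop ⊓ 𝓟 N) s}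

lemma clusterSet_mono (s : ℕ → K) {N N' : Set ℕ} (h : AlmostSub N' N) :
    clusterSet s N' ⊆ clusterSet s N := by
  have hle : (atTop : Filter ℕ) ⊓ 𝓟 N' ≤ atTop ⊓ 𝓟 N :=
    le_inf inf_le_left (le_principal_iff.2 (mem_inf_principal.2 h))
  exact fun t ht => MapClusterPt.mono ht hle

lemma clusterSet_nonempty [CompactSpace K] (s : ℕ → K) {N : Set ℕ} (h : ∃ᶠ n in atTop, n ∈ N) :
    (clusterSet s N).Nonempty := by
  have : (atTop ⊓ 𝓟 N : Filter ℕ).NeBot := frequently_mem_iff_neBot.1 h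
  exact exists_clusterPt_of_compactSpace (map s (atTop ⊓ 𝓟 N))

lemma frequently_of_mem_clusterSet {s : ℕ → K} {N : Set ℕ} {t : K} (ht : t ∈ clusterSet s N)
    {U : Set K} (hU : U ∈ 𝓝 t) : ∃ᶠ n in atTop, n ∈ N ∧ s n ∈ U := by
  have := MapClusterPt.frequently ht hU
  rw [frequently_inf_principal] at this
  exact this.mono fun n hn => hn

lemma mem_of_mem_clusterSet {s : ℕ → K} {N : Set ℕ} {t : K} (ht : t ∈ clusterSet s N)
    {U : Set K} (hU : IsClosed U) (h : ∀ᶠ n in atTop, n ∈ N → s n ∈ U) : t ∈ U := by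
  by_contra hn
  obtain ⟨n, ⟨h1, h2⟩, h3⟩ :=
    ((frequently_of_mem_clusterSet ht (hU.isOpen_compl.mem_nhds hn)).and_eventually h).exists
  exact h2 (h3 h1)

/-- The support functional of the differences `f (s n) - f t`, `f ∈ F`. -/
def gapFun (F : Set C(K, ℝ)) (s : ℕ → K) (t : K) : Ell → ℝ :=
  Ell.supFun fun (f : F) n => (f : C(K, ℝ)) (s n) - (f : C(K, ℝ)) t

section gapFun

variable {F : Set C(K, ℝ)} {M : ℝ}

lemma abs_gap_le (hF : ∀ f ∈ F, ∀ x, |f x| ≤ M) (s : ℕ → K) (t : K) (f : F) (n : ℕ) :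
    |(f : C(K, ℝ)) (s n) - (f : C(K, ℝ)) t| ≤ 2 * M := by
  have h1 := hF f f.2 (s n)
  have h2 := hF f f.2 t
  have h3 := abs_sub ((f : C(K, ℝ)) (s n)) ((f : C(K, ℝ)) t)
  linarith

lemma sublinear_gapFun (hne : F.Nonempty) (hF : ∀ f ∈ F, ∀ x, |f x| ≤ M) (s : ℕ → K) (t : K) :
    Ell.Sublinear (gapFun F s t) (2 * M) :=
  have := hne.to_subtype
  Ell.sublinear_supFun (abs_gap_le hF s t)

/-- After passing to an infinite set of indices, the gap functionals do not depend on the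
cluster point. -/
lemma exists_gapFun_eq [CompactSpace K] (hne : F.Nonempty) (hF : ∀ f ∈ F, ∀ x, |f x| ≤ M)
    (s : ℕ → K) :
    ∃ A : Set ℕ, A.Infinite ∧ ∀ t ∈ clusterSet s A, ∀ t' ∈ clusterSet s A,
      gapFun F s t = gapFun F s t' := by
  have hsub := sublinear_gapFun hne hF s
  have := hne.to_subtype
  have hlow : ∀ t a, -(2 * M * ‖a‖) ≤ gapFun F s t a := fun t a => by
    have h1 := (hsub t).add_le a (-a)
    rw [add_neg_cancel, (hsub t).zero] at h1
    have h2 := (hsub t).le_norm (-a)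
    rw [norm_neg] at h2
    linarith
  have hbdd : ∀ (a : Ell) (N : Set ℕ), BddBelow ((fun t => gapFun F s t a) '' clusterSet s N) := by
    intro a N
    refine ⟨-(2 * M * ‖a‖), ?_⟩
    rintro _ ⟨t, -, rfl⟩
    exact hlow t a
  let a : ℕ → Ell := TopologicalSpace.denseSeq Ell
  let w : ℕ → Set ℕ → ℝ := fun j N => sInf ((fun t => gapFun F s t (a j)) '' clusterSet s N)
  obtain ⟨A, hA, hstable⟩ := exists_stable w (fun j => 2 * M * ‖a j‖)
    (fun j N hN => by
      obtain ⟨t, ht⟩ := clusterSet_nonempty s hN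
      exact (csInf_le (hbdd _ _) ⟨t, ht, rfl⟩).trans ((hsub t).le_norm _))
    (fun j N N' hN' hle => csInf_le_csInf (hbdd _ _) ((clusterSet_nonempty s hN').image _)
      (Set.image_mono (clusterSet_mono s hle)))
  have heq : ∀ t ∈ clusterSet s A, ∀ j, gapFun F s t (a j) = w j A := by
    intro t ht j
    refine le_antisymm ?_ (csInf_le (hbdd _ _) ⟨t, ht, rfl⟩)
    by_contra! hlt
    obtain ⟨f, hf⟩ := exists_lt_of_lt_ciSup hlt
    set z := ∑' n, a j n * ((f : C(K, ℝ)) (s n) - (f : C(K, ℝ)) t) with hz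
    set ε := (z - w j A) / (2 * (‖a j‖ + 1)) with hε_def
    have hε : 0 < ε := div_pos (sub_pos.2 hf) (by positivity)
    let U : Set K := {x | |(f : C(K, ℝ)) x - (f : C(K, ℝ)) t| < ε}
    let V : Set K := {x | |(f : C(K, ℝ)) x - (f : C(K, ℝ)) t| ≤ ε}
    have hcont : Continuous fun x => |(f : C(K, ℝ)) x - (f : C(K, ℝ)) t| := by fun_prop
    have hU : U ∈ 𝓝 t := (isOpen_lt hcont continuous_const).mem_nhds (by simpa [U] using hε)
    let N : Set ℕ := {n | n ∈ A ∧ s n ∈ U}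
    have hN : ∃ᶠ n in atTop, n ∈ N := frequently_of_mem_clusterSet ht hU
    have hwN := hstable j N hN (Eventually.of_forall fun n hn => hn.1)
    have hge : z - ε * ‖a j‖ ≤ w j N := by
      refine le_csInf ((clusterSet_nonempty s hN).image _) ?_
      rintro _ ⟨t', ht', rfl⟩
      have h1 : t' ∈ V := mem_of_mem_clusterSet ht' (isClosed_le hcont continuous_const)
        (Eventually.of_forall fun n hn => by
          have : |(f : C(K, ℝ)) (s n) - (f : C(K, ℝ)) t| < ε := hn.2
          exact this.le)
      have h2 : ∑' n, a j n * ((f : C(K, ℝ)) (s n) - (f : C(K, ℝ)) t') ≤ gapFun F s t' (a j) :=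
        Ell.le_supFun (abs_gap_le hF s t') (a j) f
      have h3 := Ell.abs_tsum_mul_le (h := fun _ => (f : C(K, ℝ)) t' - (f : C(K, ℝ)) t)
        (fun _ => h1) (a j)
      have h4 : z = (∑' n, a j n * ((f : C(K, ℝ)) (s n) - (f : C(K, ℝ)) t')) +
          ∑' n, a j n * ((f : C(K, ℝ)) t' - (f : C(K, ℝ)) t) := by
        rw [hz, ← (Ell.summable_mul (abs_gap_le hF s t' f) (a j)).tsum_add
          (Ell.summable_mul (fun _ => h1) (a j))]
        exact tsum_congr fun n => by ring
      have h5 := (abs_le.1 h3).2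
      linarith
    have h6 : ε * (2 * (‖a j‖ + 1)) = z - w j A := by
      rw [hε_def]; field_simp
    nlinarith [mul_nonneg hε.le (norm_nonneg (a j))]
  refine ⟨A, Nat.frequently_atTop_iff_infinite.1 hA, fun t ht t' ht' => ?_⟩
  refine Continuous.ext_on (TopologicalSpace.denseRange_denseSeq Ell) (hsub t).continuous
    (hsub t').continuous ?_
  rintro _ ⟨j, rfl⟩
  exact (heq t ht j).trans (heq t' ht' j).symm

end gapFun

end

section

variable {K : Type*} [TopologicalSpace K]

/-- Every measure `∑ α n δ_{s n}` with `∑ |α n| = 1` attains its supremum on `F`. -/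
def AttainsDiscrete (F : Set C(K, ℝ)) : Prop :=
  ∀ (α : ℕ → ℝ) (s : ℕ → K), Summable (fun n => |α n|) → ∑' n, |α n| = 1 →
    ∃ f₀ ∈ F, ∀ f ∈ F, ∑' n, α n * f (s n) ≤ ∑' n, α n * f₀ (s n)

variable {F : Set C(K, ℝ)} {M : ℝ}

lemma AttainsDiscrete.exists_max (hatt : AttainsDiscrete F) (hne : F.Nonempty) (α : ℕ → ℝ)
    (s : ℕ → K) (hα : Summable fun n => |α n|) :
    ∃ f₀ ∈ F, ∀ f ∈ F, ∑' n, α n * f (s n) ≤ ∑' n, α n * f₀ (s n) := by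
  rcases (tsum_nonneg fun n => abs_nonneg (α n)).eq_or_lt with h0 | hpos
  · have hz : ∀ n, α n = 0 := fun n => abs_eq_zero.1 (congrFun
      ((hasSum_zero_iff_of_nonneg fun n => abs_nonneg (α n)).1 (h0 ▸ hα.hasSum)) n)
    obtain ⟨f₀, hf₀⟩ := hne
    exact ⟨f₀, hf₀, fun f _ => by simp [hz]⟩
  · set C := ∑' n, |α n|
    have habs : ∀ n, |C⁻¹ * α n| = C⁻¹ * |α n| := fun n => by
      rw [abs_mul, abs_of_pos (inv_pos.2 hpos)]
    obtain ⟨f₀, hf₀, hmax⟩ := hatt (fun n => C⁻¹ * α n) s (by simpa only [habs] using hα.mul_left _)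
      (by simp only [habs]; rw [tsum_mul_left, inv_mul_cancel₀ hpos.ne'])
    refine ⟨f₀, hf₀, fun f hf => ?_⟩
    have := hmax f hf
    simp only [mul_assoc, tsum_mul_left] at this
    exact le_of_mul_le_mul_left this (inv_pos.2 hpos)

lemma AttainsDiscrete.smul (hatt : AttainsDiscrete F) (hne : F.Nonempty) (σ : ℝ) :
    AttainsDiscrete ((fun f : C(K, ℝ) => σ • f) '' F) := by
  intro α s hα _
  obtain ⟨f₀, hf₀, hmax⟩ := hatt.exists_max hne (fun n => α n * σ) s (by
    simpa only [abs_mul] using hα.mul_right |σ|)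
  refine ⟨σ • f₀, ⟨f₀, hf₀, rfl⟩, ?_⟩
  rintro _ ⟨f, hf, rfl⟩
  simpa [mul_assoc] using hmax f hf

lemma AttainsDiscrete.exists_mem_gapFun_eq (hatt : AttainsDiscrete F) (hne : F.Nonempty)
    (hF : ∀ f ∈ F, ∀ x, |f x| ≤ M) (s : ℕ → K) (t : K) (b : Ell) :
    ∃ f ∈ F, gapFun F s t b = ∑' n, b n * (f (s n) - f t) := by
  let α : ℕ → ℝ := fun n => Nat.rec (-Ell.mass b) (fun n _ => b n) n
  let s' : ℕ → K := fun n => Nat.rec t (fun n _ => s n) n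
  have hα : Summable fun n => |α n| := (summable_nat_add_iff 1).1 b.summable_abs
  have hval : ∀ f ∈ F, ∑' n, α n * f (s' n) = ∑' n, b n * (f (s n) - f t) := by
    intro f hf
    have h1 : Summable fun n => b n * f (s n) := Ell.summable_mul (fun n => hF f hf (s n)) b
    have h2 : Summable fun n => b n * f t := Ell.summable_mul (fun _ => hF f hf t) b
    have h3 : Summable fun n => α n * f (s' n) := (summable_nat_add_iff 1).1 h1
    rw [h3.tsum_eq_zero_add]
    simp only [mul_sub]
    rw [h1.tsum_sub h2, tsum_mul_right]
    have hm : Ell.mass b = ∑' n, b n := by simp [Ell.mass, Ell.pair_apply]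
    change -Ell.mass b * f t + ∑' n, b n * f (s n) = _
    rw [hm]
    ring
  obtain ⟨f₀, hf₀, hmax⟩ := hatt.exists_max hne α s' hα
  have := hne.to_subtype
  refine ⟨f₀, hf₀, le_antisymm (ciSup_le fun f => ?_)
    (Ell.le_supFun (abs_gap_le hF s t) b ⟨f₀, hf₀⟩)⟩
  rw [← hval f f.2, ← hval f₀ hf₀]
  exact hmax f f.2

/-- An attaining bounded family satisfies one half of the double limit condition. -/
theorem AttainsDiscrete.false_of_double_limit [CompactSpace K] (hatt : AttainsDiscrete F)
    (hne : F.Nonempty) (hF : ∀ f ∈ F, ∀ x, |f x| ≤ M) (s : ℕ → K) (φ : ℕ → C(K, ℝ))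
    (hφ : ∀ m, φ m ∈ F) {x y : ℝ} (hxy : x < y) (hy : ∀ n, ∀ᶠ m in atTop, y ≤ φ m (s n))
    (hx : ∀ m, ∀ᶠ n in atTop, φ m (s n) ≤ x) : False := by
  obtain ⟨A, hA, hAeq⟩ := exists_gapFun_eq hne hF s
  obtain ⟨t, ht⟩ := clusterSet_nonempty s (Nat.frequently_atTop_iff_infinite.2 hA)
  have hP := sublinear_gapFun hne hF s t
  have hslope : ∀ a : Ell, (∀ n, 0 ≤ a n) → (y - x) * ‖a‖ ≤ gapFun F s t a := by
    intro a ha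
    have hsum : HasSum (fun n => (y - x) * a n) ((y - x) * ‖a‖) := by
      have h1 := a.hasSum_abs.mul_left (y - x)
      simpa only [abs_of_nonneg (ha _)] using h1
    refine le_of_tendsto_of_tendsto' hsum ((hP.continuous.tendsto a).comp a.hasSum_unit) fun S => ?_
    obtain ⟨m, hm⟩ := ((eventually_all_finset S).2 fun n _ => hy n).exists
    have htx : φ m t ≤ x := mem_of_mem_clusterSet ht (U := {z | φ m z ≤ x})
      (isClosed_le (φ m).continuous continuous_const) ((hx m).mono fun n hn _ => hn)
    have hle := Ell.le_supFun (abs_gap_le hF s t) (∑ n ∈ S, a n • Ell.unit n) ⟨φ m, hφ m⟩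
    rw [← Ell.pair_apply (abs_gap_le hF s t ⟨φ m, hφ m⟩), map_sum] at hle
    refine le_trans (Finset.sum_le_sum fun n hn => ?_) hle
    rw [map_smul, Ell.pair_unit, smul_eq_mul, mul_comm]
    exact mul_le_mul_of_nonneg_left (by linarith [hm n hn] : y - x ≤ φ m (s n) - φ m t) (ha n)
  obtain ⟨b, n, γ, ρ, hn, hρ, h⟩ := Ell.exists_perturbation hP hA (sub_pos.2 hxy) hslope
  have hfreq : ∃ᶠ k in atTop, k ∈ Set.range n :=
    Nat.frequently_atTop_iff_infinite.2 (Set.infinite_range_of_injective hn.injective)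
  obtain ⟨t', ht'⟩ := clusterSet_nonempty s hfreq
  have hsub : AlmostSub (Set.range n) A := Eventually.of_forall fun k hk => by
    obtain ⟨i, rfl⟩ := hk
    exact (h i).1
  rw [hAeq t ht t' (clusterSet_mono s hsub ht')] at h
  obtain ⟨f, hf, hfb⟩ := hatt.exists_mem_gapFun_eq hne hF s t' b
  have hgap : ∀ i, ρ ≤ f (s (n i)) - f t' := by
    intro i
    obtain ⟨-, hγ, hi⟩ := h i
    have h1 := Ell.le_supFun (abs_gap_le hF s t') (b - γ i • Ell.unit (n i)) ⟨f, hf⟩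
    rw [← Ell.pair_apply (abs_gap_le hF s t' ⟨f, hf⟩), map_sub, map_smul, Ell.pair_unit,
      smul_eq_mul, Ell.pair_apply] at h1
    have h2 : gapFun F s t' (b - γ i • Ell.unit (n i)) =
      Ell.supFun (fun (f : F) n => (f : C(K, ℝ)) (s n) - (f : C(K, ℝ)) t')
        (b - γ i • Ell.unit (n i)) := rfl
    rw [← h2] at h1
    rw [hfb] at hi
    have h3 : γ i * ρ ≤ γ i * (f (s (n i)) - f t') := by
      simp only at h1
      linarith
    exact le_of_mul_le_mul_left h3 hγ
  have hU : {z | f z - f t' < ρ} ∈ 𝓝 t' :=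
    (isOpen_lt (by fun_prop) continuous_const).mem_nhds (by simpa using hρ)
  obtain ⟨k, ⟨i, rfl⟩, hk⟩ := (frequently_of_mem_clusterSet ht' hU).exists
  exact absurd (hgap i) (not_le.2 hk)

/-- The version of `AttainsDiscrete.false_of_double_limit` for the family `σ • F`. -/
theorem AttainsDiscrete.false_of_smul_double_limit [CompactSpace K] (hatt : AttainsDiscrete F)
    (hne : F.Nonempty) (hF : ∀ f ∈ F, ∀ x, |f x| ≤ M) (σ : ℝ) (s : ℕ → K) (φ : ℕ → C(K, ℝ))
    (hφ : ∀ m, φ m ∈ F) {x y : ℝ} (hxy : x < y) (hy : ∀ n, ∀ᶠ m in atTop, y ≤ σ * φ m (s n))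
    (hx : ∀ m, ∀ᶠ n in atTop, σ * φ m (s n) ≤ x) : False := by
  refine (hatt.smul hne σ).false_of_double_limit (M := |σ| * M) (hne.image _) ?_ s
    (fun m => σ • φ m) (fun m => ⟨_, hφ m, rfl⟩) hxy (by simpa using hy) (by simpa using hx)
  rintro _ ⟨f, hf, rfl⟩ z
  rw [ContinuousMap.smul_apply, smul_eq_mul, abs_mul]
  exact mul_le_mul_of_nonneg_left (hF f hf z) (abs_nonneg σ)

end

section

variable {K : Type*} [TopologicalSpace K] {F : Set C(K, ℝ)} {M : ℝ}

/-- Pointwise limits along ultrafilters on an attaining bounded family are continuous. -/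
theorem AttainsDiscrete.continuous_limit [CompactSpace K] (hatt : AttainsDiscrete F)
    (hne : F.Nonempty) (hF : ∀ f ∈ F, ∀ x, |f x| ≤ M) (𝒰 : Ultrafilter C(K, ℝ)) (h𝒰 : F ∈ 𝒰)
    {u : K → ℝ} (hu : ∀ x, Tendsto (fun f : C(K, ℝ) => f x) 𝒰 (𝓝 (u x))) : Continuous u := by
  rw [continuous_iff_continuousAt]
  intro z
  by_contra hnot
  obtain ⟨σ, c, hσ, hc, hfreq⟩ : ∃ σ c : ℝ, |σ| = 1 ∧ 0 < c ∧ ∃ᶠ t in 𝓝 z, c ≤ σ * (u t - u z) := by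
    simp only [ContinuousAt, Metric.tendsto_nhds, not_forall] at hnot
    obtain ⟨c, hc, hnot⟩ := hnot
    have h1 : ∃ᶠ t in 𝓝 z, c ≤ 1 * (u t - u z) ∨ c ≤ -1 * (u t - u z) := by
      refine (not_eventually.1 hnot).mono fun t ht => ?_
      rw [Real.dist_eq, not_lt, le_abs] at ht
      simpa using ht
    rcases frequently_or_distrib.1 h1 with h | h
    · exact ⟨1, c, by simp, hc, h⟩
    · exact ⟨-1, c, by simp, hc, h⟩
  set ε := c / 8 with hε_def
  have hε : 0 < ε := by positivity
  have hclose : ∀ x, ∀ᶠ f : C(K, ℝ) in 𝒰, |f x - u x| < ε := fun x => by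
    simpa only [Real.dist_eq] using Metric.tendsto_nhds.1 (hu x) ε hε
  obtain ⟨p, hp, hpp⟩ := exists_seq_of_forall_finset_exists
    (fun p : C(K, ℝ) × K => p.1 ∈ F ∧ |p.1 z - u z| < ε ∧ |p.1 p.2 - p.1 z| < ε ∧
      c ≤ σ * (u p.2 - u z))
    (fun p q => |q.1 p.2 - u p.2| < ε ∧ |p.1 q.2 - p.1 z| < ε) (by
      intro S hS
      obtain ⟨f, ⟨hfF, hfz⟩, hfS⟩ := (((show ∀ᶠ f in 𝒰, f ∈ F from h𝒰).and (hclose z)).and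
        ((eventually_all_finset S).2 fun p _ => hclose p.2)).exists
      have hcont : ∀ g : C(K, ℝ), ∀ᶠ t in 𝓝 z, |g t - g z| < ε := fun g => by
        simpa only [Real.dist_eq] using Metric.tendsto_nhds.1 (g.continuous.tendsto z) ε hε
      obtain ⟨t, ht, htf, htS⟩ := (hfreq.and_eventually ((hcont f).and
        ((eventually_all_finset S).2 fun p _ => hcont p.1))).exists
      exact ⟨(f, t), ⟨hfF, hfz, htf, ht⟩, fun p hp => ⟨hfS p hp, htS p hp⟩⟩)
  have hmul : ∀ v : ℝ, |v| < ε → |σ * v| < ε := fun v hv => by rwa [abs_mul, hσ, one_mul]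
  refine hatt.false_of_smul_double_limit hne hF σ (fun n => (p n).2) (fun m => (p m).1)
    (fun m => (hp m).1) (x := σ * u z + 2 * ε) (y := σ * u z + c - ε) (by linarith)
    (fun n => ?_) fun m => ?_
  · filter_upwards [eventually_gt_atTop n] with m hm
    have h1 := abs_lt.1 (hmul _ (hpp n m hm).1)
    have h2 := (hp n).2.2.2
    linarith [h1.1]
  · filter_upwards [eventually_gt_atTop m] with n hn
    have h1 := abs_lt.1 (hmul _ (hpp m n hn).2)
    have h2 := abs_lt.1 (hmul _ (hp m).2.1)
    linarith [h1.2, h2.2]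

/-- Continuous functions on a compact space are simultaneously approximated on a finite net. -/
lemma exists_finite_net [CompactSpace K] (S : Finset C(K, ℝ)) {ε : ℝ} (hε : 0 < ε) :
    ∃ D : Finset K, ∀ t, ∃ d ∈ D, ∀ g ∈ S, |g d - g t| < ε := by
  have hopen : ∀ d : K, {t | ∀ g ∈ S, |g d - g t| < ε} ∈ 𝓝 d := fun d =>
    (eventually_all_finset S).2 fun g _ => by
      have := Metric.tendsto_nhds.1 (g.continuous.tendsto d) ε hε
      simpa only [Real.dist_eq, abs_sub_comm] using this
  obtain ⟨D, -, hD⟩ := isCompact_univ.elim_nhds_subcover _ fun d _ => hopen d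
  refine ⟨D, fun t => ?_⟩
  obtain ⟨d, hd, ht⟩ := Set.mem_iUnion₂.1 (hD (Set.mem_univ t))
  exact ⟨d, hd, ht⟩

/-- From any member of an ultrafilter containing an attaining bounded family one can extract a
sequence converging pointwise to the continuous pointwise limit of the ultrafilter. -/
theorem AttainsDiscrete.exists_seq_tendsto [CompactSpace K] (hatt : AttainsDiscrete F)
    (hne : F.Nonempty) (hF : ∀ f ∈ F, ∀ x, |f x| ≤ M) (𝒰 : Ultrafilter C(K, ℝ)) (u : C(K, ℝ))
    (hu : ∀ x, Tendsto (fun f : C(K, ℝ) => f x) 𝒰 (𝓝 (u x))) {E : Set C(K, ℝ)} (hE : E ∈ 𝒰)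
    (hEF : E ⊆ F) :
    ∃ f : ℕ → C(K, ℝ), (∀ n, f n ∈ E) ∧ ∀ x, Tendsto (fun n => f n x) atTop (𝓝 (u x)) := by
  classical
  have hr : ∀ k : ℕ, (0 : ℝ) < 1 / (k + 1) := fun k => Nat.one_div_pos_of_nat
  choose net hnet using fun (S : Finset C(K, ℝ)) (k : ℕ) => exists_finite_net S (hr k)
  obtain ⟨p, hp, hpp⟩ := exists_seq_of_forall_finset_exists
    (fun p : Finset C(K, ℝ) × ℕ × C(K, ℝ) => p.2.2 ∈ E ∧ p.2.2 ∈ p.1 ∧ u ∈ p.1)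
    (fun p q => p.1 ⊆ q.1 ∧ p.2.1 < q.2.1 ∧
      ∀ d ∈ net p.1 p.2.1, |q.2.2 d - u d| < 1 / (p.2.1 + 1 : ℝ)) (by
      intro S hS
      have hclose : ∀ᶠ f : C(K, ℝ) in 𝒰, ∀ p ∈ S, ∀ d ∈ net p.1 p.2.1,
          |f d - u d| < 1 / (p.2.1 + 1 : ℝ) :=
        (eventually_all_finset S).2 fun p _ => (eventually_all_finset _).2 fun d _ => by
          simpa only [Real.dist_eq] using Metric.tendsto_nhds.1 (hu d) _ (hr p.2.1)
      obtain ⟨f, hfE, hf⟩ := ((show ∀ᶠ f in 𝒰, f ∈ E from hE).and hclose).exists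
      refine ⟨(insert f (insert u (S.biUnion fun p => p.1)), S.sup (fun p => p.2.1) + 1, f),
        ⟨hfE, by simp, by simp⟩, fun p hp => ⟨?_, ?_, hf p hp⟩⟩
      · refine (Finset.subset_biUnion_of_mem (fun p : Finset C(K, ℝ) × ℕ × C(K, ℝ) => p.1) hp).trans ?_
        exact (Finset.subset_insert _ _).trans (Finset.subset_insert _ _)
      · exact Nat.lt_succ_of_le (Finset.le_sup (f := fun p : Finset C(K, ℝ) × ℕ × C(K, ℝ) => p.2.1) hp))
  set f : ℕ → C(K, ℝ) := fun n => (p n).2.2 with hf_def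
  have hk : ∀ n, n ≤ (p n).2.1 := fun n =>
    (strictMono_nat_of_lt_succ (f := fun n => (p n).2.1) fun n =>
      (hpp n (n + 1) n.lt_succ_self).2.1).le_apply (x := n)
  refine ⟨f, fun n => (hp n).1, fun x => ?_⟩
  by_contra hnot
  obtain ⟨σ, η, hσ, hη, hfreq⟩ : ∃ σ η : ℝ, |σ| = 1 ∧ 0 < η ∧
      ∃ᶠ n in atTop, 3 * η ≤ σ * (f n x - u x) := by
    simp only [Metric.tendsto_nhds, not_forall] at hnot
    obtain ⟨c, hc, hnot⟩ := hnot
    have h1 : ∃ᶠ n in atTop, 3 * (c / 3) ≤ 1 * (f n x - u x) ∨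
        3 * (c / 3) ≤ -1 * (f n x - u x) := by
      refine (not_eventually.1 hnot).mono fun t ht => ?_
      rw [Real.dist_eq, not_lt, le_abs] at ht
      rw [mul_div_cancel₀ c three_ne_zero]
      simpa using ht
    rcases frequently_or_distrib.1 h1 with h | h
    · exact ⟨1, c / 3, by simp, by positivity, h⟩
    · exact ⟨-1, c / 3, by simp, by positivity, h⟩
  obtain ⟨ψ, hψ, hψx⟩ := extraction_of_frequently_atTop hfreq
  choose d hdnet hd using fun k : ℕ => hnet (p k).1 (p k).2.1 x
  obtain ⟨k₀, hk₀⟩ := exists_nat_one_div_lt (half_pos hη)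
  have hsmall : ∀ n, k₀ ≤ n → 1 / ((p n).2.1 + 1 : ℝ) < η / 2 := fun n hn =>
    (one_div_le_one_div_of_le (by positivity)
      (by exact_mod_cast Nat.succ_le_succ (hn.trans (hk n)))).trans_lt hk₀
  have hmul : ∀ v ε : ℝ, |v| < ε → |σ * v| < ε := fun v ε hv => by rwa [abs_mul, hσ, one_mul]
  refine hatt.false_of_smul_double_limit hne hF (-σ) (fun n => d (k₀ + n)) (fun m => f (ψ m))
    (fun m => hEF (hp (ψ m)).1) (x := -(σ * u x) - 2 * η) (y := -(σ * u x) - η) (by linarith)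
    (fun n => ?_) fun m => ?_
  · filter_upwards [eventually_gt_atTop (k₀ + n)] with m hm
    have hs := hsmall (k₀ + n) (Nat.le_add_right _ _)
    have h1 := abs_lt.1 (hmul _ _ ((hpp (k₀ + n) (ψ m) (hm.trans_le (hψ.le_apply))).2.2 _
      (hdnet (k₀ + n))))
    have h2 := abs_lt.1 (hmul _ _ (hd (k₀ + n) u (hp (k₀ + n)).2.2))
    simp only [hf_def]
    linarith [h1.2, h2.2]
  · filter_upwards [eventually_gt_atTop (ψ m)] with n hn
    have hs := hsmall (k₀ + n) (Nat.le_add_right _ _)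
    have h1 := abs_lt.1 (hmul _ _ (hd (k₀ + n) (f (ψ m))
      ((hpp (ψ m) (k₀ + n) (hn.trans_le (Nat.le_add_left _ _))).1 (hp (ψ m)).2.1)))
    have h2 := hψx m
    linarith [h1.1]

/-- Pointwise limits along ultrafilters on an attaining bounded family are weak limits. -/
theorem AttainsDiscrete.tendsto_functional [CompactSpace K] [Nonempty K]
    (hatt : AttainsDiscrete F) (hne : F.Nonempty) (hF : ∀ f ∈ F, ∀ x, |f x| ≤ M)
    (𝒰 : Ultrafilter C(K, ℝ)) (h𝒰 : F ∈ 𝒰) (u : C(K, ℝ))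
    (hu : ∀ x, Tendsto (fun f : C(K, ℝ) => f x) 𝒰 (𝓝 (u x))) (μ : C(K, ℝ) →L[ℝ] ℝ) :
    Tendsto μ 𝒰 (𝓝 (μ u)) := by
  have hM : ∀ x, |u x| ≤ M := fun x =>
    le_of_tendsto (hu x).abs (mem_of_superset h𝒰 fun f hf => hF f hf x)
  have key : ∀ (ν : C(K, ℝ) →L[ℝ] ℝ) {ε : ℝ}, 0 < ε → ∀ᶠ f in 𝒰, ν f < ν u + ε := by
    intro ν ε hε
    by_contra hnot
    have hE : {f | f ∈ F ∧ ν u + ε ≤ ν f} ∈ 𝒰 := by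
      have h1 : ∀ᶠ f in 𝒰, ¬ ν f < ν u + ε := Ultrafilter.eventually_not.2 hnot
      filter_upwards [h𝒰, h1] with f hf h using ⟨hf, not_lt.1 h⟩
    obtain ⟨f, hfE, hf⟩ := hatt.exists_seq_tendsto hne hF 𝒰 u hu hE fun f hf => hf.1
    have hbd : ∀ x n, |f n x - u x| ≤ 2 * M := fun x n => by
      have h1 := hF _ (hfE n).1 x
      have h2 := abs_sub (f n x) (u x)
      linarith [hM x]
    have hbd' : ∀ x n, |(|f n x - u x|)| ≤ 2 * M := fun x n => by
      rw [abs_abs]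
      exact hbd x n
    have hlim : ∀ x, Tendsto (fun n => |f n x - u x|) atTop (𝓝 0) := fun x => by
      simpa using ((hf x).sub_const (u x)).abs
    obtain ⟨a, ha, hlt⟩ := Ell.exists_supFun_lt (g := fun n x => |f n x - u x|)
      (fun n => by fun_prop) hbd' hlim (δ := ε / (‖ν‖ + 1)) (by positivity)
    set δ := ε / (‖ν‖ + 1)
    have hle := Ell.le_supFun (h := fun x n => |f n x - u x|) hbd' a
    have hM0 : 0 ≤ 2 * M := (abs_nonneg _).trans (hbd (Classical.arbitrary K) 0)
    have hnorm : ∀ n, ‖f n - u‖ ≤ 2 * M := fun n =>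
      (ContinuousMap.norm_le _ hM0).2 fun x => hbd x n
    have hsm : Summable fun n => a n • (f n - u) := by
      refine Summable.of_norm_bounded (a.summable_abs.mul_right (2 * M)) fun n => ?_
      rw [norm_smul]
      exact mul_le_mul_of_nonneg_left (hnorm n) (abs_nonneg _)
    obtain ⟨g, hg⟩ := hsm
    have hpos : 0 < δ * ‖a‖ := by
      refine lt_of_le_of_lt (tsum_nonneg fun n => ?_) ((hle (Classical.arbitrary K)).trans_lt hlt)
      exact mul_nonneg (ha n) (abs_nonneg _)
    have hgn : ‖g‖ ≤ δ * ‖a‖ := by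
      refine (ContinuousMap.norm_le _ hpos.le).2 fun x => ?_
      have h1 : HasSum (fun n => a n * (f n x - u x)) (g x) :=
        hg.mapL (ContinuousMap.evalCLM ℝ x)
      rw [← h1.tsum_eq]
      refine le_trans ?_ ((hle x).trans hlt.le)
      refine tsum_of_norm_bounded (Ell.summable_mul (hbd' x) a).hasSum fun n => ?_
      rw [Real.norm_eq_abs, abs_mul, abs_of_nonneg (ha n)]
    have hνg : ε * ‖a‖ ≤ ν g := by
      have h1 : HasSum (fun n => ε * a n) (ε * ‖a‖) := by
        have := a.hasSum_abs.mul_left ε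
        simpa only [abs_of_nonneg (ha _)] using this
      refine hasSum_le (fun n => ?_) h1 (hg.mapL ν)
      rw [map_smul, map_sub, smul_eq_mul, mul_comm]
      exact mul_le_mul_of_nonneg_left (by linarith [(hfE n).2]) (ha n)
    have hup : ν g ≤ ‖ν‖ * (δ * ‖a‖) :=
      (le_abs_self _).trans ((ν.le_opNorm g).trans (mul_le_mul_of_nonneg_left hgn (norm_nonneg _)))
    have hδ : δ * (‖ν‖ + 1) = ε := div_mul_cancel₀ _ (by positivity)
    rw [← hδ] at hνg
    linarith
  rw [Metric.tendsto_nhds]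
  intro ε hε
  filter_upwards [key μ hε, key (-μ) hε] with f h1 h2
  rw [Real.dist_eq, abs_lt]
  simp only [neg_apply] at h2
  constructor <;> linarith

end

lemma exists_clm_eq_tsum {K : Type*} [TopologicalSpace K] [CompactSpace K] (α : ℕ → ℝ) (s : ℕ → K)
    (hα : Summable fun n => |α n|) :
    ∃ μ : C(K, ℝ) →L[ℝ] ℝ, ∀ f : C(K, ℝ), μ f = ∑' n, α n * f (s n) := by
  have hle : ∀ (f : C(K, ℝ)) n, ‖α n * f (s n)‖ ≤ |α n| * ‖f‖ := fun f n => by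
    rw [norm_mul]
    exact mul_le_mul_of_nonneg_left (f.norm_coe_le_norm (s n)) (abs_nonneg _)
  have hs : ∀ f : C(K, ℝ), Summable fun n => α n * f (s n) := fun f =>
    .of_norm_bounded (hα.mul_right ‖f‖) (hle f)
  have hadd : ∀ f g : C(K, ℝ),
      ∑' n, α n * (f + g) (s n) = ∑' n, α n * f (s n) + ∑' n, α n * g (s n) := fun f g => by
    rw [← (hs f).tsum_add (hs g)]
    exact tsum_congr fun n => mul_add _ _ _
  have hsmul : ∀ (c : ℝ) (f : C(K, ℝ)),
      ∑' n, α n * (c • f) (s n) = c • ∑' n, α n * f (s n) := fun c f => by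
    rw [smul_eq_mul, ← tsum_mul_left]
    exact tsum_congr fun n => mul_left_comm _ _ _
  let φ : C(K, ℝ) →ₗ[ℝ] ℝ :=
    { toFun := fun f => ∑' n, α n * f (s n), map_add' := hadd, map_smul' := hsmul }
  exact ⟨φ.mkContinuous (∑' n, |α n|) fun f =>
    tsum_of_norm_bounded (hα.hasSum.mul_right ‖f‖) (hle f), fun _ => rfl⟩

lemma attainsDiscrete_of_attains {K : Type*} [TopologicalSpace K] [CompactSpace K]
    {F : Set C(K, ℝ)} (hF : IsBounded F)
    (h : ∀ (μ : C(K, ℝ) →L[ℝ] ℝ) (α : ℕ → ℝ) (s : ℕ → K),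
      Summable (fun n => |α n|) → (∑' n, |α n|) = 1 →
      (∀ f : C(K, ℝ), μ f = ∑' n, α n * f (s n)) →
      ∃ f₀ ∈ F, μ f₀ = sSup ((fun f => μ f) '' F)) : AttainsDiscrete F := by
  intro α s hα h1
  obtain ⟨μ, hμ⟩ := exists_clm_eq_tsum α s hα
  obtain ⟨f₀, hf₀, he⟩ := h μ α s hα h1 hμ
  refine ⟨f₀, hf₀, fun f hf => ?_⟩
  have hbdd : BddAbove ((fun f => μ f) '' F) := (μ.lipschitz.isBounded_image hF).bddAbove
  rw [← hμ f, ← hμ f₀, he]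
  exact le_csSup hbdd ⟨f, hf, rfl⟩

theorem AttainsDiscrete.isCompact_weakTop {K : Type*} [TopologicalSpace K] [CompactSpace K]
    [Nonempty K] {F : Set C(K, ℝ)} (hatt : AttainsDiscrete F) (hne : F.Nonempty)
    (hF : IsBounded F) (hclosed : @IsClosed _ (weakTop C(K, ℝ)) F) :
    @IsCompact _ (weakTop C(K, ℝ)) F := by
  obtain ⟨M, hM⟩ := isBounded_iff_forall_norm_le.1 hF
  have hM' : ∀ f ∈ F, ∀ x, |f x| ≤ M := fun f hf x => (f.norm_coe_le_norm x).trans (hM f hf)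
  rw [@isCompact_iff_ultrafilter_le_nhds' _ (weakTop C(K, ℝ))]
  intro 𝒰 h𝒰
  have hlim : ∀ x : K, ∃ y : ℝ, Tendsto (fun f : C(K, ℝ) => f x) 𝒰 (𝓝 y) := fun x => by
    obtain ⟨y, -, hy⟩ := (isCompact_Icc (a := -M) (b := M)).ultrafilter_le_nhds'
      (𝒰.map fun f : C(K, ℝ) => f x)
      (Ultrafilter.mem_map.2 (mem_of_superset h𝒰 fun f hf => abs_le.1 (hM' f hf x)))
    exact ⟨y, hy⟩
  choose u hu using hlim
  have hcont := hatt.continuous_limit hne hM' 𝒰 h𝒰 hu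
  have hle : (𝒰 : Filter C(K, ℝ)) ≤ @nhds _ (weakTop C(K, ℝ)) ⟨u, hcont⟩ := by
    rw [weakTop, nhds_induced, ← tendsto_iff_comap, tendsto_pi_nhds]
    exact fun μ => hatt.tendsto_functional hne hM' 𝒰 h𝒰 ⟨u, hcont⟩ hu μ
  exact ⟨_, (@isClosed_iff_ultrafilter _ F (weakTop C(K, ℝ))).1 hclosed _ 𝒰 hle h𝒰, hle⟩

lemma exists_eq_sSup_of_isCompact_weakTop {E : Type*} [NormedAddCommGroup E] [NormedSpace ℝ E]
    {F : Set E} (hF : @IsCompact _ (weakTop E) F) (hne : F.Nonempty) (μ : E →L[ℝ] ℝ) :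
    ∃ f₀ ∈ F, μ f₀ = sSup ((fun f => μ f) '' F) := by
  have hμ : @Continuous _ _ (weakTop E) _ fun f => μ f :=
    @Continuous.comp E ((E →L[ℝ] ℝ) → ℝ) ℝ (weakTop E) Pi.topologicalSpace _ _ _
      (continuous_apply μ) continuous_induced_dom
  exact (@IsCompact.image _ _ (weakTop E) _ _ _ hF hμ).sSup_mem (hne.image _)

/-- "James2.0 for ℓ∞", Godefroy's conjecture: identifying
`ℓ∞ = C(βℕ)`, a weakly closed bounded nonempty set `F ⊆ ℓ∞` is weakly compact iff
every normalized measure with countable support `μ = Σ αₙ δ_{sₙ}` (with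
`Σ|αₙ| = 1`, `sₙ ∈ βℕ`) attains its supremum on `F`. -/
theorem stmt7
    (F : Set C(StoneCech ℕ, ℝ)) (hFne : F.Nonempty) (hFbdd : IsBounded F)
    (hFclosed : @IsClosed _ (weakTop C(StoneCech ℕ, ℝ)) F) :
    @IsCompact _ (weakTop C(StoneCech ℕ, ℝ)) F ↔
      ∀ (μ : C(StoneCech ℕ, ℝ) →L[ℝ] ℝ) (α : ℕ → ℝ) (s : ℕ → StoneCech ℕ),
        Summable (fun n => |α n|) → (∑' n, |α n|) = 1 →
        -- `μ = Σ αₙ δ_{sₙ}`: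
        (∀ f : C(StoneCech ℕ, ℝ), μ f = ∑' n, α n * f (s n)) →
        ∃ f₀ ∈ F, μ f₀ = sSup ((fun f => μ f) '' F) := by
  constructor
  · exact fun h μ _ _ _ _ _ => exists_eq_sSup_of_isCompact_weakTop h hFne μ
  · exact fun h => (attainsDiscrete_of_attains hFbdd h).isCompact_weakTop hFne hFbdd hFclosed
end
end

section
/- Let X be a real Banach space and B ⊆ B(X*) a boundary for X. A weakly closed bounded subset A of X is weakly compact if and only if A is compact in the topology τ_B of pointwise convergence on B. -/
open Filter Topology Metric Bornology

noncomputable section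

variable {X : Type*} [NormedAddCommGroup X] [NormedSpace ℝ X]

/-- The filters which play the role of subsequences. -/
def SeqFilter {α : Type*} (F : Filter α) : Prop := F.NeBot ∧ F.IsCountablyGenerated

lemma SeqFilter.inf_principal {α : Type*} {F : Filter α} (hF : SeqFilter F) {S : Set α}
    (hS : ∃ᶠ x in F, x ∈ S) : SeqFilter (F ⊓ 𝓟 S) := by
  obtain ⟨h1, h2⟩ := hF
  exact ⟨Filter.frequently_mem_iff_neBot.1 hS, inferInstance⟩

/-- Countably many bounded monotone functions of a filter can be made constant below one filter. -/
lemma exists_stable_s8 {α ι : Type*} [Countable ι] [Nonempty ι] {F₀ : Filter α} (h₀ : SeqFilter F₀)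
    (f : ι → Filter α → ℝ) (C : ι → ℝ)
    (hmono : ∀ j F G, SeqFilter F → SeqFilter G → G ≤ F → F ≤ F₀ → f j G ≤ f j F)
    (hC : ∀ j F, SeqFilter F → F ≤ F₀ → C j ≤ f j F) :
    ∃ F, SeqFilter F ∧ F ≤ F₀ ∧ ∀ G, SeqFilter G → G ≤ F → ∀ j, f j G = f j F := by
  have step : ∀ (j : ι) (ε : ℝ), 0 < ε → ∀ F, SeqFilter F ∧ F ≤ F₀ →
      ∃ G, (SeqFilter G ∧ G ≤ F₀) ∧ G ≤ F ∧
        ∀ H, SeqFilter H → H ≤ F → f j G ≤ f j H + ε := by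
    intro j ε hε F hF
    set S : Set ℝ := {r | ∃ G, SeqFilter G ∧ G ≤ F ∧ f j G = r}
    have hne : S.Nonempty := ⟨_, F, hF.1, le_rfl, rfl⟩
    have hbd : BddBelow S := by
      refine ⟨C j, ?_⟩
      rintro r ⟨G, hG, hGF, rfl⟩
      exact hC j G hG (hGF.trans hF.2)
    obtain ⟨r, ⟨G, hG, hGF, rfl⟩, hr⟩ := Real.lt_sInf_add_pos hne hε
    refine ⟨G, ⟨hG, hGF.trans hF.2⟩, hGF, fun H hH hHF => ?_⟩
    have := csInf_le hbd (show f j H ∈ S from ⟨H, hH, hHF, rfl⟩)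
    linarith
  obtain ⟨e, he⟩ := exists_surjective_nat ι
  choose! nxt hn1 hn2 hn3 using step
  let s : ℕ → Filter α := fun n =>
    Nat.rec F₀ (fun k F => nxt (e k.unpair.1) (1 / ((k.unpair.2 : ℝ) + 1)) F) n
  have hs : ∀ n, s (n + 1) = nxt (e n.unpair.1) (1 / ((n.unpair.2 : ℝ) + 1)) (s n) := fun n => rfl
  have pos : ∀ k : ℕ, (0 : ℝ) < 1 / ((k : ℝ) + 1) := fun k => Nat.one_div_pos_of_nat
  have hgood : ∀ n, SeqFilter (s n) ∧ s n ≤ F₀ := by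
    intro n
    induction n with
    | zero => exact ⟨h₀, le_rfl⟩
    | succ n ih => rw [hs]; exact hn1 _ _ (pos _) _ ih
  have hanti : Antitone s := antitone_nat_of_succ_le fun n => by
    rw [hs]; exact hn2 _ _ (pos _) _ (hgood n)
  have hinf : SeqFilter (⨅ n, s n) := by
    constructor
    · exact Filter.iInf_neBot_of_directed' hanti.directed_ge fun n => (hgood n).1.1
    · have : ∀ n, (s n).IsCountablyGenerated := fun n => (hgood n).1.2
      exact @Filter.iInf.isCountablyGenerated _ _ _ s this
  have hle0 : ⨅ n, s n ≤ F₀ := iInf_le s 0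
  refine ⟨⨅ n, s n, hinf, hle0, fun G hG hGle j => ?_⟩
  refine le_antisymm (hmono _ _ _ hinf hG hGle hle0) ?_
  obtain ⟨i, rfl⟩ := he j
  refine le_of_forall_pos_le_add fun ε hε => ?_
  obtain ⟨k, hk⟩ := exists_nat_one_div_lt hε
  have h1 := hn3 (e i) (1 / ((k : ℝ) + 1)) (pos k) (s (Nat.pair i k)) (hgood _) G hG
    (hGle.trans (iInf_le _ _))
  have h2 := hs (Nat.pair i k)
  simp only [Nat.unpair_pair] at h2
  rw [← h2] at h1
  have h3 := hmono (e i) (s (Nat.pair i k + 1)) _ (hgood (Nat.pair i k + 1)).1 hinf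
    (iInf_le s (Nat.pair i k + 1))
    (hgood (Nat.pair i k + 1)).2
  linarith

/-- The values of `x` at the functionals in `B`. -/
def evalOn (B : Set (X →L[ℝ] ℝ)) (x : X) : B → ℝ := fun b => (b : X →L[ℝ] ℝ) x

/-- The cluster points in `A` of the filter `F`, for pointwise convergence on `B`. -/
def clusters (B : Set (X →L[ℝ] ℝ)) (A : Set X) (F : Filter X) : Set X :=
  {w | w ∈ A ∧ MapClusterPt (evalOn B w) F (evalOn B)}

/-- The largest distance from `h` to a cluster point of `F`. -/
def farDist (B : Set (X →L[ℝ] ℝ)) (A : Set X) (F : Filter X) (h : X) : ℝ :=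
  ⨆ w : clusters B A F, ‖h - w‖

lemma clusters_mono {B : Set (X →L[ℝ] ℝ)} {A : Set X} {F G : Filter X} (h : G ≤ F) :
    clusters B A G ⊆ clusters B A F := fun _ hw => ⟨hw.1, hw.2.mono h⟩

lemma clusters_nonempty {B : Set (X →L[ℝ] ℝ)} {A : Set X} (hcpt : IsCompact (evalOn B '' A))
    {F : Filter X} [F.NeBot] (hF : F ≤ 𝓟 A) : (clusters B A F).Nonempty := by
  have : Filter.map (evalOn B) F ≤ 𝓟 (evalOn B '' A) := by
    rw [← Filter.map_principal]; exact Filter.map_mono hF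
  obtain ⟨_, ⟨w, hw, rfl⟩, hc⟩ := hcpt this
  exact ⟨w, hw, hc⟩

lemma le_clusters {B : Set (X →L[ℝ] ℝ)} {A : Set X} {F : Filter X} {w : X}
    (hw : w ∈ clusters B A F) {b : X →L[ℝ] ℝ} (hb : b ∈ B) {r : ℝ} (hr : ∀ᶠ x in F, r ≤ b x) :
    r ≤ b w := by
  by_contra! h
  have hc : Continuous fun p : B → ℝ => p ⟨b, hb⟩ := continuous_apply _
  have h1 : ∃ᶠ x in F, b x < r :=
    hw.2.frequently ((isOpen_lt hc continuous_const).mem_nhds (show _ < r from h))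
  obtain ⟨x, h1, h2⟩ := (h1.and_eventually hr).exists
  linarith

section farDist

variable {B : Set (X →L[ℝ] ℝ)} {A : Set X} {R : ℝ}

lemma bddAbove_farDist (hR : ∀ a ∈ A, ‖a‖ ≤ R) (F : Filter X) (h : X) :
    BddAbove (Set.range fun w : clusters B A F => ‖h - w‖) := by
  refine ⟨‖h‖ + R, ?_⟩
  rintro _ ⟨w, rfl⟩
  have := hR w w.2.1
  exact (norm_sub_le _ _).trans (by gcongr)

lemma le_farDist (hR : ∀ a ∈ A, ‖a‖ ≤ R) {F : Filter X} {w : X} (hw : w ∈ clusters B A F) (h : X) :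
    ‖h - w‖ ≤ farDist B A F h :=
  le_ciSup (bddAbove_farDist hR F h) ⟨w, hw⟩

lemma farDist_nonneg (F : Filter X) (h : X) : 0 ≤ farDist B A F h :=
  Real.iSup_nonneg fun _ => norm_nonneg _

lemma farDist_mono (hR : ∀ a ∈ A, ‖a‖ ≤ R) {F G : Filter X} (hGF : G ≤ F) (h : X) :
    farDist B A G h ≤ farDist B A F h :=
  Real.iSup_le (fun w => le_farDist hR (clusters_mono hGF w.2) h) (farDist_nonneg _ _)

lemma exists_lt_farDist {F : Filter X} (hne : (clusters B A F).Nonempty) {h : X} {r : ℝ}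
    (hr : r < farDist B A F h) : ∃ w ∈ clusters B A F, r < ‖h - w‖ := by
  have : Nonempty (clusters B A F) := hne.to_subtype
  obtain ⟨w, hw⟩ := exists_lt_of_lt_ciSup hr
  exact ⟨w, w.2, hw⟩

lemma lipschitz_farDist (hR : ∀ a ∈ A, ‖a‖ ≤ R) (F : Filter X) :
    LipschitzWith 1 (farDist B A F) := by
  refine LipschitzWith.of_le_add fun x y => ?_
  refine Real.iSup_le (fun w => ?_) (add_nonneg (farDist_nonneg _ _) dist_nonneg)
  have h1 := le_farDist hR w.2 y
  have h2 : ‖x - w‖ ≤ ‖y - w‖ + ‖x - y‖ := by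
    have : x - (w : X) = (y - w) + (x - y) := by abel
    rw [this]; exact norm_add_le _ _
  rw [dist_eq_norm]
  linarith

end farDist

lemma LipschitzWith.le_add_norm {E : Type*} [SeminormedAddCommGroup E] {φ : E → ℝ}
    (hφ : LipschitzWith 1 φ) (x y : E) : φ x ≤ φ y + ‖x - y‖ := by
  have := hφ.le_add_mul x y
  rwa [dist_eq_norm, NNReal.coe_one, one_mul] at this

/-- The limit along `F` of the infimum of `φ (u + q • g)` over convex combinations `g`. -/
def hullVal (φ : X → ℝ) (F : Filter X) (u : X) (q : ℝ) : ℝ :=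
  sSup {r | ∃ V ∈ F, ∀ g ∈ convexHull ℝ V, r ≤ φ (u + q • g)}

section hullVal

variable {φ : X → ℝ} {A : Set X} {R : ℝ}

lemma bddAbove_hullVal (hφ : LipschitzWith 1 φ) (hR : ∀ a ∈ A, ‖a‖ ≤ R) {F : Filter X} [F.NeBot]
    (hF : F ≤ 𝓟 A) (u : X) (q : ℝ) :
    BddAbove {r | ∃ V ∈ F, ∀ g ∈ convexHull ℝ V, r ≤ φ (u + q • g)} := by
  refine ⟨φ u + |q| * R, ?_⟩
  rintro r ⟨V, hV, h⟩
  obtain ⟨x, hxV, hxA⟩ := F.nonempty_of_mem (inter_mem hV (le_principal_iff.1 hF))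
  have h1 := h x (subset_convexHull ℝ V hxV)
  have h2 := hφ.le_add_norm (u + q • x) u
  rw [add_sub_cancel_left, norm_smul, Real.norm_eq_abs] at h2
  have := mul_le_mul_of_nonneg_left (hR x hxA) (abs_nonneg q)
  linarith

lemma nonempty_hullVal (h0 : ∀ h, 0 ≤ φ h) (F : Filter X) (u : X) (q : ℝ) :
    {r | ∃ V ∈ F, ∀ g ∈ convexHull ℝ V, r ≤ φ (u + q • g)}.Nonempty :=
  ⟨0, Set.univ, univ_mem, fun _ _ => h0 _⟩

lemma le_hullVal (hφ : LipschitzWith 1 φ) (hR : ∀ a ∈ A, ‖a‖ ≤ R) {F : Filter X} [F.NeBot]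
    (hF : F ≤ 𝓟 A) {u : X} {q r : ℝ} {V : Set X} (hV : V ∈ F)
    (h : ∀ g ∈ convexHull ℝ V, r ≤ φ (u + q • g)) : r ≤ hullVal φ F u q :=
  le_csSup (bddAbove_hullVal hφ hR hF u q) ⟨V, hV, h⟩

lemma exists_hullVal_sub_le (h0 : ∀ h, 0 ≤ φ h) (F : Filter X) (u : X) (q : ℝ) {ε : ℝ}
    (hε : 0 < ε) : ∃ V ∈ F, ∀ g ∈ convexHull ℝ V, hullVal φ F u q - ε ≤ φ (u + q • g) := by
  obtain ⟨r, ⟨V, hV, h⟩, hr⟩ :=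
    exists_lt_of_lt_csSup (nonempty_hullVal h0 F u q) (sub_lt_self (hullVal φ F u q) hε)
  exact ⟨V, hV, fun g hg => hr.le.trans (h g hg)⟩

lemma exists_le_hullVal_add (hφ : LipschitzWith 1 φ) (hR : ∀ a ∈ A, ‖a‖ ≤ R) {F : Filter X}
    [F.NeBot] (hF : F ≤ 𝓟 A) (u : X) (q : ℝ) {ε : ℝ} (hε : 0 < ε) {V : Set X} (hV : V ∈ F) :
    ∃ g ∈ convexHull ℝ V, φ (u + q • g) ≤ hullVal φ F u q + ε := by
  by_contra! h
  have := le_hullVal hφ hR hF hV fun g hg => (h g hg).le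
  linarith

lemma hullVal_mono (hφ : LipschitzWith 1 φ) (h0 : ∀ h, 0 ≤ φ h) (hR : ∀ a ∈ A, ‖a‖ ≤ R)
    {F G : Filter X} [G.NeBot] (hG : G ≤ 𝓟 A) (hGF : G ≤ F) (u : X) (q : ℝ) :
    hullVal φ F u q ≤ hullVal φ G u q := by
  refine csSup_le (nonempty_hullVal h0 F u q) ?_
  rintro r ⟨V, hV, h⟩
  exact le_hullVal hφ hR hG (hGF hV) h

lemma lipschitz_hullVal (hφ : LipschitzWith 1 φ) (h0 : ∀ h, 0 ≤ φ h) (hR : ∀ a ∈ A, ‖a‖ ≤ R)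
    {F : Filter X} [F.NeBot] (hF : F ≤ 𝓟 A) (q : ℝ) :
    LipschitzWith 1 fun u => hullVal φ F u q := by
  refine LipschitzWith.of_le_add fun x y => ?_
  refine csSup_le (nonempty_hullVal h0 F x q) ?_
  rintro r ⟨V, hV, h⟩
  rw [← sub_le_iff_le_add]
  refine le_hullVal hφ hR hF hV fun g hg => ?_
  have h1 := h g hg
  have h2 := hφ.le_add_norm (x + q • g) (y + q • g)
  rw [add_sub_add_right_eq_sub] at h2
  rw [dist_eq_norm]
  linarith

end hullVal

/-- A filter for which both the farthest distance `φ` to its cluster points and the numbers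
`hullVal φ` do not change under refinement, on a set `Y`. -/
structure IsStable (B : Set (X →L[ℝ] ℝ)) (A : Set X) (Y : Set X) (φ : X → ℝ) (F : Filter X) :
    Prop where
  seq : SeqFilter F
  le_principal : F ≤ 𝓟 A
  lipschitz : LipschitzWith 1 φ
  nonneg : ∀ h, 0 ≤ φ h
  norm_le : ∀ w ∈ clusters B A F, ∀ h, ‖h - w‖ ≤ φ h
  farDist_eq : ∀ G, SeqFilter G → G ≤ F → ∀ h ∈ Y, farDist B A G h = φ h
  hullVal_eq : ∀ G, SeqFilter G → G ≤ F → ∀ h ∈ Y, ∀ q : ℚ, hullVal φ G h q = hullVal φ F h q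

lemma exists_isStable {B : Set (X →L[ℝ] ℝ)} {A : Set X} {R : ℝ} (hR : ∀ a ∈ A, ‖a‖ ≤ R)
    {Y : Set X} (hY : TopologicalSpace.IsSeparable Y) {F₀ : Filter X} (h₀ : SeqFilter F₀)
    (hF₀ : F₀ ≤ 𝓟 A) : ∃ φ F, F ≤ F₀ ∧ IsStable B A Y φ F := by
  obtain ⟨c, hc, hYc⟩ := hY
  wlog hcne : c.Nonempty generalizing c
  · refine this {0} (Set.countable_singleton _) ?_ (Set.singleton_nonempty _)
    rw [Set.not_nonempty_iff_eq_empty.1 hcne, closure_empty] at hYc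
    exact hYc.trans (Set.empty_subset _)
  have := hc.to_subtype
  have := hcne.to_subtype
  obtain ⟨F₁, hF₁, hF₁₀, hst₁⟩ := exists_stable_s8 (ι := c) h₀ (fun h F => farDist B A F h) (fun _ => 0)
    (fun j F G _ _ hGF _ => farDist_mono hR hGF j) (fun j F _ _ => farDist_nonneg _ _)
  set φ := farDist B A F₁
  have hφ : LipschitzWith 1 φ := lipschitz_farDist hR F₁
  have h0 : ∀ h, 0 ≤ φ h := farDist_nonneg F₁
  obtain ⟨F, hF, hFF₁, hst⟩ := exists_stable_s8 (ι := c × ℚ) hF₁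
    (fun j F => - hullVal φ F j.1 j.2) (fun j => - (φ j.1 + |(j.2 : ℝ)| * R))
    (fun j F G _ hG hGF hF1 => by
      have := hG.1
      exact neg_le_neg (hullVal_mono hφ h0 hR (hGF.trans (hF1.trans (hF₁₀.trans hF₀))) hGF _ _))
    (fun j F hF hF1 => by
      have := hF.1
      refine neg_le_neg (csSup_le (nonempty_hullVal h0 _ _ _) ?_)
      rintro r ⟨V, hV, h⟩
      obtain ⟨x, hxV, hxA⟩ := F.nonempty_of_mem
        (inter_mem hV (le_principal_iff.1 (hF1.trans (hF₁₀.trans hF₀))))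
      have h1 := h x (subset_convexHull ℝ V hxV)
      have h2 := hφ.le_add_norm (j.1 + (j.2 : ℝ) • x) j.1
      rw [add_sub_cancel_left, norm_smul, Real.norm_eq_abs] at h2
      have := mul_le_mul_of_nonneg_left (hR x hxA) (abs_nonneg (j.2 : ℝ))
      linarith)
  refine ⟨φ, F, hFF₁.trans hF₁₀, hF, hFF₁.trans (hF₁₀.trans hF₀), hφ, h0, ?_, ?_, ?_⟩
  · intro w hw h
    exact le_farDist hR (clusters_mono hFF₁ hw) h
  · intro G hG hGF h hh
    have : Set.EqOn (farDist B A G) φ c := fun h hh => hst₁ G hG (hGF.trans hFF₁) ⟨h, hh⟩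
    exact this.closure (lipschitz_farDist hR G).continuous hφ.continuous (hYc hh)
  · intro G hG hGF h hh q
    have := hG.1
    have := hF.1
    have heq : Set.EqOn (fun u => hullVal φ G u q) (fun u => hullVal φ F u q) c :=
      fun h hh => neg_injective (hst G hG hGF (⟨h, hh⟩, q))
    have hFA := hFF₁.trans (hF₁₀.trans hF₀)
    exact heq.closure (lipschitz_hullVal hφ h0 hR (hGF.trans hFA) q).continuous
      (lipschitz_hullVal hφ h0 hR hFA q).continuous (hYc hh)

/-- Partial sums of the series with terms `g k` and weights `q k - q (k + 1)`. -/
def weightedSum (q : ℕ → ℚ) (g : ℕ → X) (n : ℕ) : X :=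
  ∑ k ∈ Finset.range n, ((q k : ℝ) - q (k + 1)) • g k

/-- The sequence `g` of convex combinations almost minimizes `φ (uₙ + qₙ g)` at each step, while the
sets `V` force the later points to be almost as far as possible from `uₙ + qₙ gₙ`. -/
structure IsGame (B : Set (X →L[ℝ] ℝ)) (φ : X → ℝ) (F : Filter X) (W : ℕ → Set X) (q : ℕ → ℚ)
    (τ : ℕ → ℝ) (V : ℕ → Set X) (g : ℕ → X) : Prop where
  subset_succ : ∀ n, V (n + 1) ⊆ V n
  subset : ∀ n, V n ⊆ W n
  mem : ∀ n, g n ∈ convexHull ℝ (V n)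
  le_of_mem : ∀ n, ∀ g' ∈ convexHull ℝ (V n),
    hullVal φ F (weightedSum q g n) (q n) - τ n ≤ φ (weightedSum q g n + (q n : ℝ) • g')
  le_add : ∀ n, φ (weightedSum q g n + (q n : ℝ) • g n) ≤
    hullVal φ F (weightedSum q g n) (q n) + τ n
  far : ∀ n, ∃ b ∈ B, ∀ x ∈ V (n + 1),
    φ (weightedSum q g n + (q n : ℝ) • g n) - τ n ≤ b (weightedSum q g n + (q n : ℝ) • g n - x)

lemma exists_isGame {B : Set (X →L[ℝ] ℝ)} (hB : ∀ x : X, ∃ b ∈ B, b x = ‖x‖) {A : Set X} {R : ℝ}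
    (hR : ∀ a ∈ A, ‖a‖ ≤ R) (hcpt : IsCompact (evalOn B '' A)) {Y : Submodule ℝ X} {φ : X → ℝ}
    {F : Filter X} (hF : IsStable B A Y φ F) (hY : (Y : Set X) ∈ F) {W : ℕ → Set X}
    (hW : ∀ n, W n ∈ F) (q : ℕ → ℚ) {τ : ℕ → ℝ} (hτ : ∀ n, 0 < τ n) :
    ∃ V g, IsGame B φ F W q τ V g := by
  have step : ∀ (n : ℕ) (s : Set X × X), SeqFilter (F ⊓ 𝓟 s.1) ∧ s.2 ∈ Y →
      ∃ (V N : Set X) (g : X), (SeqFilter (F ⊓ 𝓟 N) ∧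
        s.2 + ((q n : ℝ) - q (n + 1)) • g ∈ Y) ∧ V ⊆ s.1 ∧ V ⊆ W n ∧ N ⊆ V ∧
        g ∈ convexHull ℝ V ∧
        (∀ g' ∈ convexHull ℝ V, hullVal φ F s.2 (q n) - τ n ≤ φ (s.2 + (q n : ℝ) • g')) ∧
        φ (s.2 + (q n : ℝ) • g) ≤ hullVal φ F s.2 (q n) + τ n ∧
        ∃ b ∈ B, ∀ x ∈ N, φ (s.2 + (q n : ℝ) • g) - τ n ≤ b (s.2 + (q n : ℝ) • g - x) := by
    rintro n ⟨N, u⟩ ⟨hN, hu⟩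
    simp only at hN hu ⊢
    set G := F ⊓ 𝓟 N with hG
    have hGF : G ≤ F := inf_le_left
    have hGA : G ≤ 𝓟 A := hGF.trans hF.le_principal
    have := hN.1
    have heq := hF.hullVal_eq G hN hGF u hu (q n)
    obtain ⟨V₀, hV₀, hV₀'⟩ := exists_hullVal_sub_le hF.nonneg F u (q n) (hτ n)
    set V : Set X := V₀ ∩ W n ∩ Y ∩ N
    have hVG : V ∈ G := inter_mem (hGF (inter_mem (inter_mem hV₀ (hW n)) hY))
      (le_principal_iff.1 inf_le_right)
    obtain ⟨g, hg, hgle⟩ := exists_le_hullVal_add hF.lipschitz hR hGA u (q n) (hτ n) hVG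
    rw [heq] at hgle
    have hgY : g ∈ Y := convexHull_min (fun x hx => hx.1.2) Y.convex hg
    have hzY : u + (q n : ℝ) • g ∈ Y := Y.add_mem hu (Y.smul_mem _ hgY)
    have hfar := hF.farDist_eq G hN hGF _ hzY
    obtain ⟨w, hw, hlt⟩ := exists_lt_farDist (clusters_nonempty hcpt hGA)
      (h := u + (q n : ℝ) • g) (r := φ (u + (q n : ℝ) • g) - τ n)
      (by rw [hfar]; linarith [hτ n])
    obtain ⟨b, hb, hbw⟩ := hB (u + (q n : ℝ) • g - w)
    rw [← hbw] at hlt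
    set N' : Set X := V ∩ {x | φ (u + (q n : ℝ) • g) - τ n ≤ b (u + (q n : ℝ) • g - x)}
    have hfreq : ∃ᶠ x in G, x ∈ N' := by
      by_contra hcon
      rw [not_frequently] at hcon
      have : ∀ᶠ x in G, b (u + (q n : ℝ) • g) - (φ (u + (q n : ℝ) • g) - τ n) ≤ b x := by
        filter_upwards [hcon, hVG] with x hx hxV
        by_contra! hlt'
        refine hx ⟨hxV, ?_⟩
        simp only [Set.mem_ofPred_eq, map_sub]
        linarith
      have := le_clusters hw hb this
      rw [map_sub] at hlt
      linarith
    refine ⟨V, N', g, ⟨?_, Y.add_mem hu (Y.smul_mem _ hgY)⟩, fun x hx => hx.2,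
      fun x hx => hx.1.1.2, fun x hx => hx.1, hg, fun g' hg' => hV₀' g' ?_, hgle, b, hb,
      fun x hx => hx.2⟩
    · have h2 := hN.inf_principal hfreq
      rwa [hG, inf_assoc, inf_principal, Set.inter_eq_right.2 fun x hx => hx.1.2] at h2
    · exact convexHull_mono (fun x hx => hx.1.1.1) hg'
  choose! V N g h1 h2 h3 h4 h5 h6 h7 h8 using step
  let s : ℕ → Set X × X := fun n => Nat.rec (Set.univ, 0)
    (fun k t => (N k t, t.2 + ((q k : ℝ) - q (k + 1)) • g k t)) n
  have hs : ∀ n, s (n + 1) = (N n (s n), (s n).2 + ((q n : ℝ) - q (n + 1)) • g n (s n)) :=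
    fun n => rfl
  have hinv : ∀ n, SeqFilter (F ⊓ 𝓟 (s n).1) ∧ (s n).2 ∈ Y := by
    intro n
    induction n with
    | zero =>
      refine ⟨?_, Y.zero_mem⟩
      change SeqFilter (F ⊓ 𝓟 Set.univ)
      rw [principal_univ, inf_top_eq]
      exact hF.seq
    | succ n ih => rw [hs]; exact h1 n _ ih
  have hsum : ∀ n, (s n).2 = weightedSum q (fun k => g k (s k)) n := by
    intro n
    induction n with
    | zero => rfl
    | succ n ih => rw [hs, weightedSum, Finset.sum_range_succ, ← weightedSum, ← ih]
  refine ⟨fun n => V n (s n), fun n => g n (s n), ?_, ?_, ?_, ?_, ?_, ?_⟩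
  · intro n
    exact (h2 (n + 1) _ (hinv (n + 1))).trans (h4 n _ (hinv n))
  · exact fun n => h3 n _ (hinv n)
  · exact fun n => h5 n _ (hinv n)
  · intro n; rw [← hsum]; exact h6 n _ (hinv n)
  · intro n; rw [← hsum]; exact h7 n _ (hinv n)
  · intro n
    rw [← hsum]
    obtain ⟨b, hb, hx⟩ := h8 n _ (hinv n)
    exact ⟨b, hb, fun x hxV => hx x (h2 (n + 1) _ (hinv (n + 1)) hxV)⟩

/-- If `g n` is a convex combination of points of `V n`, then the weights of these combinations
do not vanish asymptotically near some point `w` of the compact set. -/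
lemma exists_support {B : Set (X →L[ℝ] ℝ)} {A : Set X} (hcpt : IsCompact (evalOn B '' A))
    {V : ℕ → Set X} (hV : ∀ n, V n ⊆ A) {g : ℕ → X} (hg : ∀ n, g n ∈ convexHull ℝ (V n)) :
    ∃ w ∈ A, (∀ O ∈ 𝓝 (evalOn B w), ∃ᶠ n in atTop, ∃ x ∈ V n, evalOn B x ∈ O) ∧
      ∀ b ∈ B, ∀ l : ℝ, (∀ ε > 0, ∀ᶠ n in atTop, ∀ x ∈ V n, b x ≤ l + ε) →
        (∀ ε > 0, ∀ᶠ n in atTop, l - ε ≤ b (g n)) → l ≤ b w := by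
  simp_rw [mem_convexHull_iff_exists_fintype] at hg
  choose ι hι m z hm hsum hz hgz using hg
  classical
  set mass : ℕ → Set (B → ℝ) → ℝ := fun n S => ∑ i, if evalOn B (z n i) ∈ S then m n i else 0
    with hmass
  have mass_nonneg : ∀ n S, 0 ≤ mass n S := fun n S =>
    Finset.sum_nonneg fun i _ => by split_ifs; exacts [hm n i, le_rfl]
  have mass_mono : ∀ n {S S'}, S ⊆ S' → mass n S ≤ mass n S' := by
    intro n S S' h
    refine Finset.sum_le_sum fun i _ => ?_
    by_cases h1 : evalOn B (z n i) ∈ S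
    · rw [if_pos h1, if_pos (h h1)]
    · rw [if_neg h1]; split_ifs; exacts [hm n i, le_rfl]
  have mass_union : ∀ n S S', mass n (S ∪ S') ≤ mass n S + mass n S' := by
    intro n S S'
    rw [hmass, ← Finset.sum_add_distrib]
    refine Finset.sum_le_sum fun i _ => ?_
    have := hm n i
    by_cases h1 : evalOn B (z n i) ∈ S <;> by_cases h2 : evalOn B (z n i) ∈ S' <;>
      simp [h1, h2, this]
  have hw : ∃ w ∈ A, ∀ O ∈ 𝓝 (evalOn B w), ¬ Tendsto (fun n => mass n O) atTop (𝓝 0) := by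
    by_contra! hcon
    have h := hcpt.induction_on (p := fun S => Tendsto (fun n => mass n S) atTop (𝓝 0))
      (by simp [hmass])
      (fun S S' hS h => squeeze_zero (fun n => mass_nonneg n _) (fun n => mass_mono n hS) h)
      (fun S S' h h' => squeeze_zero (fun n => mass_nonneg n _) (fun n => mass_union n S S')
        (by simpa using h.add h'))
      (by
        rintro _ ⟨w, hw, rfl⟩
        obtain ⟨O, hO, h⟩ := hcon w hw
        exact ⟨O, mem_nhdsWithin_of_mem_nhds hO, h⟩)
    have h1 : ∀ n, mass n (evalOn B '' A) = 1 := fun n => by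
      rw [← hsum n]
      exact Finset.sum_congr rfl fun i _ => if_pos ⟨_, hV n (hz n i), rfl⟩
    simp only [h1] at h
    exact one_ne_zero (tendsto_nhds_unique tendsto_const_nhds h)
  obtain ⟨w, hwA, hw⟩ := hw
  refine ⟨w, hwA, fun O hO => ?_, fun b hb l hle hge => ?_⟩
  · by_contra hcon
    rw [not_frequently] at hcon
    refine hw O hO ((tendsto_congr' ?_).1 tendsto_const_nhds)
    filter_upwards [hcon] with n hn
    exact (Finset.sum_eq_zero fun i _ => if_neg fun h => hn ⟨_, hz n i, h⟩).symm
  · by_contra! hlt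
    obtain ⟨θ, hθ, hθ'⟩ : ∃ θ > 0, b w < l - θ := ⟨(l - b w) / 2, by linarith, by linarith⟩
    have hc : Continuous fun p : B → ℝ => p ⟨b, hb⟩ := continuous_apply _
    set O : Set (B → ℝ) := {p | p ⟨b, hb⟩ < l - θ}
    refine hw O ((isOpen_lt hc continuous_const).mem_nhds hθ') ?_
    rw [Metric.tendsto_atTop']
    intro ε hε
    have hε' : 0 < ε * θ / 4 := by positivity
    obtain ⟨N, hN⟩ := eventually_atTop.1 ((hle _ hε').and (hge _ hε'))
    refine ⟨N, fun n hn => ?_⟩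
    obtain ⟨h1, h2⟩ := hN n hn.le
    rw [Real.dist_eq, sub_zero, abs_of_nonneg (mass_nonneg _ _)]
    have h3 : b (g n) ≤ l + ε * θ / 4 - θ * mass n O := by
      calc b (g n) = ∑ i, m n i * b (z n i) := by rw [← hgz n]; simp
        _ ≤ ∑ i, (m n i * (l + ε * θ / 4) -
            θ * (if evalOn B (z n i) ∈ O then m n i else 0)) := by
          refine Finset.sum_le_sum fun i _ => ?_
          split_ifs with h
          · have h4 : b (z n i) < l - θ := h
            have := mul_le_mul_of_nonneg_left (show b (z n i) ≤ l + ε * θ / 4 - θ by linarith)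
              (hm n i)
            linarith
          · have := mul_le_mul_of_nonneg_left (h1 _ (hz n i)) (hm n i)
            linarith
        _ = _ := by
          rw [Finset.sum_sub_distrib, ← Finset.sum_mul, hsum n, ← Finset.mul_sum, one_mul]
    by_contra! h5
    have := mul_le_mul_of_nonneg_left h5 hθ.le
    nlinarith

section weightedSum

variable {q : ℕ → ℚ} {g : ℕ → X} {R : ℝ}

lemma weightedSum_succ (q : ℕ → ℚ) (g : ℕ → X) (n : ℕ) :
    weightedSum q g (n + 1) = weightedSum q g n + ((q n : ℝ) - q (n + 1)) • g n :=
  Finset.sum_range_succ _ _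

lemma norm_weightedSum_sub_le (hq : Antitone q) (hg : ∀ n, ‖g n‖ ≤ R) (n m : ℕ) (h : n ≤ m) :
    ‖weightedSum q g m - weightedSum q g n‖ ≤ ((q n : ℝ) - q m) * R := by
  induction m, h using Nat.le_induction with
  | base => simp
  | succ m h ih =>
    have h1 : (0 : ℝ) ≤ q m - q (m + 1) := sub_nonneg.2 (by exact_mod_cast hq m.le_succ)
    have h2 : ‖((q m : ℝ) - q (m + 1)) • g m‖ ≤ (q m - q (m + 1)) * R := by
      rw [norm_smul, Real.norm_of_nonneg h1]
      exact mul_le_mul_of_nonneg_left (hg m) h1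
    rw [weightedSum_succ, add_sub_right_comm]
    refine (norm_add_le _ _).trans ?_
    linarith

lemma exists_tendsto_weightedSum [CompleteSpace X] (hq : Antitone q) (hq0 : ∀ n, 0 < q n)
    (hqt : Tendsto (fun n => (q n : ℝ)) atTop (𝓝 0)) (hg : ∀ n, ‖g n‖ ≤ R) :
    ∃ y, Tendsto (weightedSum q g) atTop (𝓝 y) ∧ ∀ n, ‖y - weightedSum q g n‖ ≤ q n * R := by
  have hR : 0 ≤ R := (norm_nonneg _).trans (hg 0)
  have key : ∀ n m, n ≤ m → ‖weightedSum q g m - weightedSum q g n‖ ≤ q n * R := by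
    intro n m h
    refine (norm_weightedSum_sub_le hq hg n m h).trans (mul_le_mul_of_nonneg_right ?_ hR)
    have : (0 : ℝ) < q m := by exact_mod_cast hq0 m
    linarith
  have hc : CauchySeq (weightedSum q g) := by
    refine cauchySeq_of_le_tendsto_0' (fun n => (q n : ℝ) * R) (fun n m h => ?_)
      (by simpa using hqt.mul_const R)
    rw [dist_comm, dist_eq_norm]
    exact key n m h
  obtain ⟨y, hy⟩ := cauchySeq_tendsto_of_complete hc
  refine ⟨y, hy, fun n => le_of_tendsto (hy.sub_const _).norm ?_⟩
  filter_upwards [eventually_ge_atTop n] with m hm using key n m hm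

lemma exists_weightedSum_eq (hq : Antitone q) (hq0 : ∀ n, 0 < q n) {V : ℕ → Set X}
    (hV : ∀ n, V (n + 1) ⊆ V n) (hg : ∀ n, g n ∈ convexHull ℝ (V n)) (n m : ℕ) (h : n ≤ m) :
    ∀ g' ∈ convexHull ℝ (V m), ∃ c ∈ convexHull ℝ (V n),
      weightedSum q g m + (q m : ℝ) • g' = weightedSum q g n + (q n : ℝ) • c := by
  induction m, h using Nat.le_induction with
  | base => exact fun g' hg' => ⟨g', hg', rfl⟩
  | succ m h ih =>
    intro g' hg'
    have h0 : (0 : ℝ) < q m := by exact_mod_cast hq0 m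
    have h0' : (0 : ℝ) < q (m + 1) := by exact_mod_cast hq0 (m + 1)
    have h1 : (q (m + 1) : ℝ) ≤ q m := by exact_mod_cast hq m.le_succ
    obtain ⟨c, hc, hc'⟩ := ih (((q m - q (m + 1)) / q m : ℝ) • g m + (q (m + 1) / q m : ℝ) • g')
      (convex_convexHull ℝ _ (hg m) (convexHull_mono (hV m) hg')
        (div_nonneg (by linarith) h0.le) (by positivity) (by field_simp; ring))
    refine ⟨c, hc, ?_⟩
    rw [← hc', weightedSum_succ, smul_add, smul_smul, smul_smul, mul_div_cancel₀ _ h0.ne',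
      mul_div_cancel₀ _ h0.ne', add_assoc]

end weightedSum

lemma hullVal_zero_one_le [CompleteSpace X] {B : Set (X →L[ℝ] ℝ)} (hBball : B ⊆ closedBall 0 1)
    (hB : ∀ x : X, ∃ b ∈ B, b x = ‖x‖) {A : Set X} {R : ℝ}
    (hR : ∀ a ∈ A, ‖a‖ ≤ R) (hcpt : IsCompact (evalOn B '' A)) {Y : Submodule ℝ X} {φ : X → ℝ}
    {F : Filter X} (hF : IsStable B A Y φ F) (hY : (Y : Set X) ∈ F) :
    hullVal φ F 0 1 ≤ 0 := by
  by_contra! hT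
  set T := hullVal φ F 0 1 with hTdef
  have hne := hF.seq.1
  have hcg := hF.seq.2
  have hAF : A ∈ F := le_principal_iff.1 hF.le_principal
  have hR0 : 0 ≤ R := by
    obtain ⟨a, ha⟩ := F.nonempty_of_mem hAF
    exact (norm_nonneg _).trans (hR a ha)
  obtain ⟨W₀, hW₀⟩ := F.exists_antitone_basis
  set W : ℕ → Set X := fun n => W₀ n ∩ (A ∩ Y)
  have hW : ∀ n, W n ∈ F := fun n => inter_mem (hW₀.1.mem_of_mem trivial) (inter_mem hAF hY)
  -- the parameters
  set κ := T / 4 with hκ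
  have hκ0 : 0 < κ := by positivity
  obtain ⟨δ, hδ0, hδ⟩ : ∃ δ : ℚ, (0 : ℝ) < δ ∧ (δ : ℝ) < min 1 (κ / (4 * (R + 1))) := by
    exact exists_rat_btwn (lt_min one_pos (by positivity))
  have hδ1 : (δ : ℝ) < 1 := hδ.trans_le (min_le_left _ _)
  have hδR : 2 * R * δ ≤ κ / 2 := by
    have h1 : (δ : ℝ) < κ / (4 * (R + 1)) := hδ.trans_le (min_le_right _ _)
    rw [lt_div_iff₀ (by positivity)] at h1
    nlinarith
  set q : ℕ → ℚ := fun n => ∏ k ∈ Finset.range n, δ / 2 ^ (k + 1) with hq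
  have hq_zero : q 0 = 1 := by simp [hq]
  have hq_succ : ∀ n, q (n + 1) = q n * (δ / 2 ^ (n + 1)) := fun n => Finset.prod_range_succ _ _
  have hq_succ' : ∀ n, (q (n + 1) : ℝ) = q n * (δ / 2 ^ (n + 1)) := fun n => by
    rw [hq_succ]; push_cast; rfl
  have hδ0' : 0 < δ := by exact_mod_cast hδ0
  have hq0 : ∀ n, 0 < q n := fun n => Finset.prod_pos fun k _ => by positivity
  have hq0' : ∀ n, (0 : ℝ) < q n := fun n => by exact_mod_cast hq0 n
  have hqhalf : ∀ n, (q (n + 1) : ℝ) ≤ q n * (1 / 2) := fun n => by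
    rw [hq_succ']
    refine mul_le_mul_of_nonneg_left ?_ (hq0' n).le
    refine div_le_div₀ zero_le_one hδ1.le two_pos ?_
    exact le_self_pow₀ one_le_two n.succ_ne_zero
  have hqanti : Antitone q := antitone_nat_of_succ_le fun n => by
    have h1 := hqhalf n
    have h2 := hq0' n
    exact_mod_cast (by linarith : (q (n + 1) : ℝ) ≤ q n)
  have hqpow : ∀ n, (q n : ℝ) ≤ (1 / 2) ^ n := by
    intro n
    induction n with
    | zero => simp [hq_zero]
    | succ n ih => rw [pow_succ]; exact (hqhalf n).trans (by gcongr)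
  have hqt : Tendsto (fun n => (q n : ℝ)) atTop (𝓝 0) :=
    squeeze_zero (fun n => (hq0' n).le) hqpow
      (tendsto_pow_atTop_nhds_zero_of_lt_one (by norm_num) (by norm_num))
  set p : ℕ → ℝ := fun n => κ * (1 / 2) ^ n with hp
  have hp0 : ∀ n, 0 < p n := fun n => by positivity
  have hp_succ : ∀ n, p (n + 1) = p n / 2 := fun n => by simp only [hp, pow_succ]; ring
  have hpt : Tendsto p atTop (𝓝 0) := by
    simpa [hp] using (tendsto_pow_atTop_nhds_zero_of_lt_one (r := (1 / 2 : ℝ))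
      (by norm_num) (by norm_num)).const_mul κ
  set τ : ℕ → ℝ := fun n => q (n + 1) * (p (n + 1) / 4)
  have hτ : ∀ n, 0 < τ n := fun n => mul_pos (hq0' _) (by linarith [hp0 (n + 1)])
  have hRq : ∀ n, 2 * R * q (n + 1) ≤ q n * (p (n + 1) / 2) := by
    intro n
    have h1 : (0 : ℝ) < (1 / 2) ^ (n + 1) := by positivity
    have h2 : 2 * R * q (n + 1) = q n * ((2 * R * δ) * (1 / 2) ^ (n + 1)) := by
      rw [hq_succ', one_div_pow]; ring
    rw [h2]
    refine mul_le_mul_of_nonneg_left ?_ (hq0' n).le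
    have := mul_le_mul_of_nonneg_right hδR h1.le
    simp only [hp]
    linarith
  obtain ⟨V, g, hG⟩ := exists_isGame hB hR hcpt hF hY hW q hτ
  set u := weightedSum q g with hu
  have hVA : ∀ n, V n ⊆ A := fun n x hx => (hG.subset n hx).2.1
  have hgR : ∀ n, ‖g n‖ ≤ R := fun n => by
    have : convexHull ℝ (V n) ⊆ closedBall 0 R :=
      convexHull_min (fun x hx => mem_closedBall_zero_iff.2 (hR x (hVA n hx)))
        (convex_closedBall _ _)
    exact mem_closedBall_zero_iff.1 (this (hG.mem n))
  have hgY : ∀ n, g n ∈ Y := fun n =>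
    convexHull_min (fun x hx => (hG.subset n hx).2.2) Y.convex (hG.mem n)
  have huY : ∀ n, u n ∈ Y := fun n => Y.sum_mem fun k _ => Y.smul_mem _ (hgY k)
  obtain ⟨y, hy, hyu⟩ := exists_tendsto_weightedSum hqanti hq0 hqt hgR
  rw [← hu] at hy
  have hφc := hF.lipschitz.continuous
  have hz : Tendsto (fun n => u n + (q n : ℝ) • g n) atTop (𝓝 y) := by
    have : Tendsto (fun n => (q n : ℝ) • g n) atTop (𝓝 0) := by
      refine squeeze_zero_norm (a := fun n => (q n : ℝ) * R) (fun n => ?_)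
        (by simpa using hqt.mul_const R)
      rw [norm_smul, Real.norm_of_nonneg (hq0' n).le]
      exact mul_le_mul_of_nonneg_left (hgR n) (hq0' n).le
    simpa using hy.add this
  have hφy : ∀ n, hullVal φ F (u n) (q n) - τ n ≤ φ y := by
    intro n
    refine ge_of_tendsto ((hφc.tendsto y).comp hz) ?_
    filter_upwards [eventually_ge_atTop n] with m hm
    obtain ⟨c, hc, h⟩ := exists_weightedSum_eq hqanti hq0 hG.subset_succ hG.mem n m hm _ (hG.mem m)
    simp only [Function.comp, hu]
    rw [h]
    exact hG.le_of_mem n c hc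
  obtain ⟨w, hwA, hwO, hwb⟩ := exists_support hcpt hVA hG.mem
  have hVmono : Antitone V := antitone_nat_of_succ_le hG.subset_succ
  have hwF : w ∈ clusters B A F := by
    refine ⟨hwA, mapClusterPt_iff_frequently.2 fun O hO => ?_⟩
    rw [frequently_iff]
    intro U hU
    obtain ⟨n, -, hn⟩ := hW₀.1.mem_iff.1 hU
    obtain ⟨m, hm, x, hx, hxO⟩ := frequently_atTop.1 (hwO O hO) n
    exact ⟨x, hn (hG.subset n (hVmono hm hx)).1, hxO⟩
  have hBnorm : ∀ b ∈ B, ∀ x, |b x| ≤ ‖x‖ := fun b hb x => by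
    have := b.le_of_opNorm_le (mem_closedBall_zero_iff.1 (hBball hb)) x
    rwa [one_mul, Real.norm_eq_abs] at this
  have hfar : ∀ n, φ (u n + (q n : ℝ) • g n) - τ n ≤ ‖u n + (q n : ℝ) • g n - w‖ := by
    intro n
    obtain ⟨b, hb, hx⟩ := hG.far n
    refine le_trans ?_ ((le_abs_self _).trans (hBnorm b hb _))
    by_contra! hlt
    have hc : Continuous fun p : B → ℝ => p ⟨b, hb⟩ := continuous_apply _
    rw [map_sub] at hlt
    have hO : {p : B → ℝ | b (u n + (q n : ℝ) • g n) - (φ (u n + (q n : ℝ) • g n) - τ n) <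
      p ⟨b, hb⟩} ∈ 𝓝 (evalOn B w) :=
      (isOpen_lt continuous_const hc).mem_nhds (show _ < b w by linarith)
    obtain ⟨m, hm, x, hxV, hxO⟩ := frequently_atTop.1 (hwO _ hO) (n + 1)
    have h1 := hx x (hVmono hm hxV)
    have h2 : b (u n + (q n : ℝ) • g n) - (φ (u n + (q n : ℝ) • g n) - τ n) < b x := hxO
    rw [map_sub] at h1
    simp only [hu] at h2
    linarith
  have hτt : Tendsto τ atTop (𝓝 0) := by
    have := (hqt.comp (tendsto_add_atTop_nat 1)).mul
      ((hpt.comp (tendsto_add_atTop_nat 1)).div_const 4)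
    simpa using this
  have hyw : ‖y - w‖ = φ y := by
    refine le_antisymm (hF.norm_le w hwF y) ?_
    refine le_of_tendsto_of_tendsto' (by simpa using ((hφc.tendsto y).comp hz).sub hτt)
      (hz.sub_const w).norm hfar
  obtain ⟨b, hb, hbyw⟩ := hB (y - w)
  rw [hyw, map_sub] at hbyw
  have hbA : ∀ᶠ x in F, |b x| ≤ R := by
    filter_upwards [hAF] with x hx using (hBnorm b hb x).trans (hR x hx)
  have hbdd : F.IsBoundedUnder (· ≤ ·) fun x => b x :=
    isBoundedUnder_of_eventually_le (hbA.mono fun x hx => (abs_le.1 hx).2)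
  have hcobdd : F.IsCoboundedUnder (· ≤ ·) fun x => b x :=
    (isBoundedUnder_of_eventually_ge (hbA.mono fun x hx => (abs_le.1 hx).1)).isCoboundedUnder_le
  set l := limsup (fun x => b x) F
  -- lower estimates for `b (g n)`
  have E0 : ∀ n, b (u n) + q n * l - b w ≤ hullVal φ F (u n) (q n) := by
    intro n
    refine le_of_forall_pos_le_add fun ε hε => ?_
    have hfreq : ∃ᶠ x in F, x ∈ {x | l - ε < b x} :=
      frequently_lt_of_lt_limsup hcobdd (by linarith)
    have hseq := hF.seq.inf_principal hfreq
    have := hseq.1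
    rw [← hF.hullVal_eq _ hseq inf_le_left (u n) (huY n) (q n), ← sub_le_iff_le_add]
    refine le_hullVal hF.lipschitz hR (inf_le_left.trans hF.le_principal)
      (le_principal_iff.1 inf_le_right) fun c hc => ?_
    refine le_trans ?_ (hF.norm_le w hwF _)
    refine le_trans ?_ ((le_abs_self _).trans (hBnorm b hb _))
    have hc' : l - ε < b c :=
      convexHull_min (t := {x | l - ε < b x}) subset_rfl
        (convex_halfSpace_gt b.isLinear _) hc
    rw [map_sub, map_add, map_smul, smul_eq_mul]
    have h1 := mul_le_mul_of_nonneg_left hc'.le (hq0' n).le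
    have h2 : (q n : ℝ) ≤ 1 := (hqpow n).trans (pow_le_one₀ (by norm_num) (by norm_num))
    nlinarith
  have hbR : ∀ n, |b (g n)| ≤ R := fun n => (hBnorm b hb _).trans (hgR n)
  have hbu : ∀ n, |b y - b (u n)| ≤ q n * R := fun n => by
    rw [← map_sub]; exact (hBnorm b hb _).trans (hyu n)
  have hbus : ∀ n, b (u (n + 1)) = b (u n) + (q n - q (n + 1)) * b (g n) := fun n => by
    rw [hu, weightedSum_succ, map_add, map_smul, smul_eq_mul]
  have hrem : ∀ n, |b y - b (u n) - q n * b (g n)| ≤ 2 * R * q (n + 1) := by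
    intro n
    have h1 := abs_le.1 (hbu (n + 1))
    have h2 := abs_le.1 (hbR n)
    have h3 := mul_le_mul_of_nonneg_left h2.1 (hq0' (n + 1)).le
    have h4 := mul_le_mul_of_nonneg_left h2.2 (hq0' (n + 1)).le
    rw [hbus] at h1
    rw [abs_le]
    constructor <;> linarith
  have E1 : ∀ n, l ≤ b (g n) + p n := by
    intro n
    have h1 := E0 n
    have h2 := hφy n
    have h3 := (abs_le.1 (hrem n)).2
    have h4 := hRq n
    have h5 : τ n ≤ q n * (p (n + 1) / 4) :=
      mul_le_mul_of_nonneg_right (by exact_mod_cast hqanti n.le_succ) (by linarith [hp0 (n + 1)])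
    have h6 := mul_pos (hq0' n) (hp0 n)
    rw [hp_succ] at h4 h5
    refine le_of_mul_le_mul_left ?_ (hq0' n)
    nlinarith
  have hlw : l ≤ b w := by
    refine hwb b hb l (fun ε hε => ?_) (fun ε hε => ?_)
    · have h1 := eventually_lt_of_limsup_lt (show l < l + ε by linarith) hbdd
      obtain ⟨n, -, hn⟩ := hW₀.1.mem_iff.1 h1
      filter_upwards [eventually_ge_atTop n] with m hm x hx
      have h2 : b x < l + ε := hn (hG.subset n (hVmono hm hx)).1
      exact h2.le
    · filter_upwards [hpt.eventually (gt_mem_nhds hε)] with n hn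
      linarith [E1 n]
  -- `b (g n)` is almost increasing
  have E2 : ∀ n, b (g n) ≤ b (g (n + 1)) + p (n + 1) := by
    intro n
    have h1 := hF.norm_le w hwF (u n + (q n : ℝ) • g n)
    have h2 := (le_abs_self _).trans (hBnorm b hb (u n + (q n : ℝ) • g n - w))
    rw [map_sub, map_add, map_smul, smul_eq_mul] at h2
    have h3 := hG.le_add n
    have h4 := hφy n
    have h5 := (abs_le.1 (hrem (n + 1))).2
    have h6 := hRq (n + 1)
    have h7 := hbus n
    rw [hp_succ] at h6
    refine le_of_mul_le_mul_left ?_ (hq0' (n + 1))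
    have h8 : τ n = q (n + 1) * (p (n + 1) / 4) := rfl
    have h9 := mul_pos (hq0' (n + 1)) (hp0 (n + 1))
    simp only [← hu] at h3
    nlinarith
  have hg0 : b (g 0) ≤ l + κ := by
    have h1 : ∀ n, b (g 0) ≤ b (g n) + (κ - p n) := by
      intro n
      induction n with
      | zero => simp [hp]
      | succ n ih =>
        have h1 := E2 n
        have h2 := hp_succ n
        linarith
    refine le_of_forall_pos_le_add fun ε hε => ?_
    have h2 := eventually_lt_of_limsup_lt (show l < l + ε by linarith) hbdd
    obtain ⟨n, -, hn⟩ := hW₀.1.mem_iff.1 h2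
    have h3 : convexHull ℝ (V n) ⊆ {x | b x < l + ε} :=
      convexHull_min (fun x hx => hn (hG.subset n hx).1) (convex_halfSpace_lt b.isLinear _)
    have h4 : b (g n) < l + ε := h3 (hG.mem n)
    have := h1 n
    have := hp0 n
    linarith
  have h1 := hφy 0
  have h2 := (abs_le.1 (hrem 0)).2
  have h3 := hRq 0
  have h4 : u 0 = 0 := rfl
  have h5 : τ 0 ≤ κ / 2 := by
    have h6 : τ 0 = q 1 * (p 1 / 4) := rfl
    have h7 : (q 1 : ℝ) ≤ 1 / 2 := by simpa using hqpow 1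
    have h8 : p 1 = κ / 2 := by simp [hp]; ring
    rw [h6, h8]
    nlinarith
  have h6 : p 1 = κ / 2 := by simp [hp]; ring
  rw [h4, hq_zero, Rat.cast_one, ← hTdef] at h1
  rw [h4, hq_zero, Rat.cast_one, map_zero] at h2
  rw [hq_zero, Rat.cast_one, zero_add, h6] at h3
  have h7 : T = 4 * κ := by rw [hκ]; ring
  rw [zero_add] at h2
  linarith

lemma exists_weak_limit [CompleteSpace X] {B : Set (X →L[ℝ] ℝ)} (hBball : B ⊆ closedBall 0 1)
    (hB : ∀ x : X, ∃ b ∈ B, b x = ‖x‖) {A : Set X} {R : ℝ}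
    (hR : ∀ a ∈ A, ‖a‖ ≤ R) (hcpt : IsCompact (evalOn B '' A)) {x : ℕ → X} (hx : ∀ n, x n ∈ A) :
    ∃ v ∈ A, v ∈ closure (Submodule.span ℝ (Set.range x) : Set X) ∧
      ∃ F : Filter X, F.NeBot ∧ F ≤ map x atTop ∧
        ∀ f : X →L[ℝ] ℝ, Tendsto f F (𝓝 (f v)) := by
  have hseq : SeqFilter (map x atTop) := ⟨inferInstance, inferInstance⟩
  have hA : map x atTop ≤ 𝓟 A := le_principal_iff.2 (mem_map.2 (Eventually.of_forall hx))
  obtain ⟨φ, F, hFx, hF⟩ := exists_isStable (B := B) hR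
    (((Set.countable_range x).isSeparable).span (R := ℝ)) hseq hA
  have hne := hF.seq.1
  set Y := Submodule.span ℝ (Set.range x)
  have hY : (Y : Set X) ∈ F :=
    hFx (mem_map.2 (Eventually.of_forall fun n => Submodule.subset_span ⟨n, rfl⟩))
  have hT := hullVal_zero_one_le hBball hB hR hcpt hF hY
  obtain ⟨v, hv⟩ := clusters_nonempty hcpt hF.le_principal
  have small : ∀ G, SeqFilter G → G ≤ F → ∀ V ∈ G, ∀ ε > 0, ∃ g ∈ convexHull ℝ V, ‖g - v‖ ≤ ε := by
    intro G hG hGF V hV ε hε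
    have := hG.1
    obtain ⟨g, hg, h⟩ := exists_le_hullVal_add hF.lipschitz hR (hGF.trans hF.le_principal) 0 1 hε hV
    have h1 := hF.hullVal_eq G hG hGF 0 Y.zero_mem 1
    rw [Rat.cast_one] at h1
    rw [h1, zero_add, one_smul] at h
    exact ⟨g, hg, (hF.norm_le v hv g).trans (by linarith)⟩
  have upper : ∀ (f : X →L[ℝ] ℝ) (θ : ℝ), 0 < θ → ∀ᶠ z in F, f z < f v + θ := by
    intro f θ hθ
    by_contra hcon
    simp only [not_eventually, not_lt] at hcon
    obtain ⟨g, hg, h⟩ := small _ (hF.seq.inf_principal (S := {z | f v + θ ≤ f z}) hcon) inf_le_left _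
      (le_principal_iff.1 inf_le_right) (θ / (2 * (‖f‖ + 1))) (by positivity)
    have h1 : f v + θ ≤ f g :=
      convexHull_min (t := {z | f v + θ ≤ f z}) subset_rfl (convex_halfSpace_ge f.isLinear _) hg
    have h2 := (le_abs_self _).trans (f.le_opNorm (g - v))
    rw [map_sub] at h2
    rw [le_div_iff₀ (by positivity)] at h
    nlinarith [norm_nonneg f, norm_nonneg (g - v)]
  refine ⟨v, hv.1, Metric.mem_closure_iff.2 fun ε hε => ?_, F, hne, hFx, fun f => ?_⟩
  · obtain ⟨g, hg, h⟩ := small F hF.seq le_rfl _ hY (ε / 2) (by positivity)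
    rw [Y.convex.convexHull_eq] at hg
    refine ⟨g, hg, ?_⟩
    rw [dist_comm, dist_eq_norm]
    linarith
  · refine Metric.tendsto_nhds.2 fun ε hε => ?_
    filter_upwards [upper f ε hε, upper (-f) ε hε] with z h1 h2
    rw [_root_.neg_apply, _root_.neg_apply] at h2
    rw [Real.dist_eq, abs_lt]
    constructor <;> linarith

lemma eventually_lt_of_isCompact [CompleteSpace X] {B : Set (X →L[ℝ] ℝ)}
    (hBball : B ⊆ closedBall 0 1) (hB : ∀ x : X, ∃ b ∈ B, b x = ‖x‖) {A : Set X} {R : ℝ}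
    (hR : ∀ a ∈ A, ‖a‖ ≤ R) (hcpt : IsCompact (evalOn B '' A)) {w : X} (f : X →L[ℝ] ℝ)
    {θ : ℝ} (hθ : 0 < θ) :
    ∃ O ∈ 𝓝 (evalOn B w), ∀ x ∈ A, evalOn B x ∈ O → f x < f w + θ := by
  by_contra! hcon
  classical
  have hd : ∀ S : Finset X, ∃ d : ℕ → X,
      (Submodule.span ℝ (S : Set X) : Set X) ⊆ closure (Set.range d) := by
    intro S
    obtain ⟨c, hc, hSc⟩ := (S.countable_toSet.isSeparable).span (R := ℝ)
    have hne : c.Nonempty := by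
      rw [Set.nonempty_iff_ne_empty]
      rintro rfl
      simpa using hSc (Submodule.zero_mem _)
    obtain ⟨d, rfl⟩ := hc.exists_eq_range hne
    exact ⟨d, hSc⟩
  choose d hd using hd
  choose b hbB hb using hB
  have step : ∀ (n : ℕ) (S : Finset X), ∃ x ∈ A, f w + θ ≤ f x ∧
      ∀ S' ⊆ S, ∀ k ≤ n, |b (d S' k) (x - w)| < 1 / ((n : ℝ) + 1) := by
    intro n S
    have hO : {p : B → ℝ | ∀ S' ∈ S.powerset, ∀ k ∈ Finset.range (n + 1),
        |p ⟨b (d S' k), hbB _⟩ - b (d S' k) w| < 1 / ((n : ℝ) + 1)} ∈ 𝓝 (evalOn B w) := by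
      refine (S.powerset.eventually_all).2 fun S' _ =>
        ((Finset.range (n + 1)).eventually_all).2 fun k _ => ?_
      have hc : Continuous fun p : B → ℝ => |p ⟨b (d S' k), hbB _⟩ - b (d S' k) w| := by fun_prop
      refine (isOpen_lt hc continuous_const).mem_nhds ?_
      simp only [Set.mem_ofPred_eq, evalOn, sub_self, abs_zero]
      positivity
    obtain ⟨x, hxA, hxO, hx⟩ := hcon _ hO
    refine ⟨x, hxA, hx, fun S' hS' k hk => ?_⟩
    rw [map_sub]
    exact hxO S' (Finset.mem_powerset.2 hS') k (Finset.mem_range.2 (Nat.lt_succ_of_le hk))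
  choose nxt hn1 hn2 hn3 using step
  obtain ⟨s, hs0, hs⟩ : ∃ s : ℕ → Finset X, s 0 = {w} ∧
      ∀ n, s (n + 1) = insert (nxt n (s n)) (s n) :=
    ⟨fun n => Nat.rec {w} (fun k S => insert (nxt k S) S) n, rfl, fun n => rfl⟩
  have hsmono : Monotone s := monotone_nat_of_le_succ fun n => by
    rw [hs]; exact Finset.subset_insert _ _
  set x : ℕ → X := fun n => nxt n (s n)
  have hws : ∀ n, w ∈ s n := fun n => hsmono n.zero_le (by simp [hs0])
  have hxs : ∀ n, x n ∈ s (n + 1) := fun n => by rw [hs]; exact Finset.mem_insert_self _ _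
  obtain ⟨v, hvA, hvY, F, hFne, hFx, hv⟩ := exists_weak_limit hBball (fun x => ⟨b x, hbB x, hb x⟩)
    hR hcpt (x := x) fun n => hn1 _ _
  have hvf : f w + θ ≤ f v := by
    refine ge_of_tendsto (hv f) (hFx (mem_map.2 (Eventually.of_forall fun n => hn2 _ _)))
  have hbv : ∀ m k, b (d (s m) k) (v - w) = 0 := by
    intro m k
    rw [map_sub, sub_eq_zero]
    refine tendsto_nhds_unique (hv _) (Tendsto.mono_left ?_ hFx)
    rw [tendsto_map'_iff, Metric.tendsto_atTop]
    intro ε hε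
    obtain ⟨N, hN⟩ := exists_nat_one_div_lt hε
    refine ⟨max N (max m k), fun n hn => ?_⟩
    have h1 := hn3 n (s n) (s m) (hsmono ((le_max_left m k).trans ((le_max_right _ _).trans hn))) k
      ((le_max_right m k).trans ((le_max_right _ _).trans hn))
    have h2 : (N : ℝ) ≤ n := by exact_mod_cast (le_max_left _ _).trans hn
    rw [Function.comp, Real.dist_eq, ← map_sub]
    refine h1.trans (lt_of_le_of_lt ?_ hN)
    exact one_div_le_one_div_of_le (by positivity) (by linarith)
  set P : ℕ → Submodule ℝ X := fun m => Submodule.span ℝ (s m)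
  have hspan : (Submodule.span ℝ (Set.range x) : Set X) ⊆ ⋃ m, P m := by
    have hdir : Monotone P :=
      fun m n h => Submodule.span_mono (Finset.coe_subset.2 (hsmono h))
    rw [← Submodule.coe_iSup_of_directed _ hdir.directed_le]
    refine Submodule.span_le.2 ?_
    rintro _ ⟨n, rfl⟩
    exact Submodule.mem_iSup_of_mem (n + 1) (Submodule.subset_span (hxs n))
  have hvw : v - w = 0 := by
    rw [← norm_le_zero_iff]
    refine le_of_forall_pos_le_add fun ε hε => ?_
    obtain ⟨y, hy, hvy⟩ := Metric.mem_closure_iff.1 hvY (ε / 4) (by positivity)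
    obtain ⟨m, hm⟩ := Set.mem_iUnion.1 (hspan hy)
    have hyw : y - w ∈ P m :=
      Submodule.sub_mem _ hm (Submodule.subset_span (hws m))
    obtain ⟨_, ⟨k, rfl⟩, hk⟩ := Metric.mem_closure_iff.1 (hd _ hyw) (ε / 4) (by positivity)
    rw [dist_eq_norm] at hvy hk
    set h := d (s m) k
    have h1 : ‖(v - w) - h‖ ≤ ε / 2 := by
      have : (v - w) - h = (v - y) + ((y - w) - h) := by abel
      rw [this]
      exact (norm_add_le _ _).trans (by linarith)
    have h2 : ‖h‖ = b h (h - (v - w)) := by rw [map_sub, hbv, sub_zero, hb]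
    have h3 := (b h).le_of_opNorm_le (mem_closedBall_zero_iff.1 (hBball (hbB h))) (h - (v - w))
    rw [one_mul, norm_sub_rev h, ← h2, norm_norm] at h3
    have h4 : ‖v - w‖ ≤ ‖(v - w) - h‖ + ‖h‖ := by
      simpa using norm_add_le ((v - w) - h) h
    linarith
  rw [sub_eq_zero.1 hvw] at hvf
  linarith

lemma isCompact_induced_of_tendsto {α β γ : Type*} [TopologicalSpace β] [TopologicalSpace γ]
    {a : α → β} {c : α → γ} {S : Set α} (h : @IsCompact α (.induced a inferInstance) S)
    (hc : ∀ w ∈ S, Tendsto c (comap a (𝓝 (a w)) ⊓ 𝓟 S) (𝓝 (c w))) :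
    @IsCompact α (.induced c inferInstance) S := by
  have h1 : IsCompact (c '' S) := by
    let _ : TopologicalSpace α := .induced a inferInstance
    refine h.image_of_continuousOn fun w hw => ?_
    rw [ContinuousWithinAt, nhdsWithin, nhds_induced]
    exact hc w hw
  let _ : TopologicalSpace α := .induced c inferInstance
  exact (IsInducing.induced c).isCompact_iff.2 h1

/-- the boundary theorem: if `B ⊆ B(X*)` is a boundary for `X`, then a
weakly closed bounded set `A ⊆ X` is weakly compact iff it is τ_B-compact. -/
theorem stmt8 {X : Type*} [NormedAddCommGroup X] [NormedSpace ℝ X] [CompleteSpace X]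
    (B : Set (X →L[ℝ] ℝ)) (hBball : B ⊆ Metric.closedBall 0 1)
    -- `B` is a boundary for `X`:
    (hB : ∀ x : X, ∃ b ∈ B, b x = ‖x‖)
    (A : Set X) (hAbdd : IsBounded A)
    (hAclosed : @IsClosed X (weakTop X) A) :
    @IsCompact X (weakTop X) A ↔ @IsCompact X (ptwTop B) A := by
  obtain ⟨R, hR⟩ := hAbdd.exists_norm_le
  constructor
  · intro h
    refine isCompact_induced_of_tendsto h fun w _ => tendsto_pi_nhds.2 fun b => ?_
    have hc : Continuous fun p : (X →L[ℝ] ℝ) → ℝ => p b := continuous_apply (b : X →L[ℝ] ℝ)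
    exact ((hc.tendsto _).comp tendsto_comap).mono_left inf_le_left
  · intro h
    have hcpt : IsCompact (evalOn B '' A) :=
      @IsCompact.image X _ (ptwTop B) _ A (evalOn B) h continuous_induced_dom
    refine isCompact_induced_of_tendsto h fun w _ => tendsto_pi_nhds.2 fun f => ?_
    refine Metric.tendsto_nhds.2 fun ε hε => ?_
    obtain ⟨O₁, hO₁, h₁⟩ := eventually_lt_of_isCompact hBball hB hR hcpt (w := w) f hε
    obtain ⟨O₂, hO₂, h₂⟩ := eventually_lt_of_isCompact hBball hB hR hcpt (w := w) (-f) hε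
    have hO : evalOn B ⁻¹' (O₁ ∩ O₂) ∈ comap (evalOn B) (𝓝 (evalOn B w)) :=
      preimage_mem_comap (inter_mem hO₁ hO₂)
    filter_upwards [mem_inf_of_left hO, mem_inf_of_right (mem_principal_self A)] with x hx hxA
    have h3 := h₁ x hxA hx.1
    have h4 := h₂ x hxA hx.2
    rw [_root_.neg_apply, _root_.neg_apply] at h4
    rw [Real.dist_eq, abs_lt]
    constructor <;> linarith
end
end
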